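/- arXiv:0805.4512 — 2 statements merged into one kernel-verified Lean document; each statement's English description precedes it below -/
import Mathlib

section
/- Let p be an odd prime, t ≥ 1, r = p^t and k ∈ E(r). For 0 ≤ i ≤ k−1 the rational number b_i = (−1)^{k−1−i} C(k−1,i) (2i+1)^{−1} has nonnegative p-adic valuation, so its reduction b̄_i ∈ F_p is defined; and with P_k(T) = (T²−1)^k and Q_k(T) = Σ_{i=0}^{k−1} b̄_i T^{2i+1} in F_p[T], the identity P_k(T)/Q_k(T) = [v̄_{1,k}T, …, v̄_{2k,k}T] holds in F_p(T), where v̄_{i,k} ∈ F_p* is the reduction mod p of v_{i,k}. -/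
open Polynomial

noncomputable section

/-- The rational numbers `v_{i,k}`: `v 1 = 2k-1`,
`v (i+1) * v i = (2k-2i-1)(2k-2i+1)/(i(2k-i))` for `1 ≤ i ≤ 2k-1`. -/
def vRat (k : ℕ) : ℕ → ℚ
  | 0 => 1
  | 1 => 2 * (k : ℚ) - 1
  | j + 2 =>
      ((2 * (k : ℚ) - 2 * ((j : ℚ) + 1) - 1) * (2 * (k : ℚ) - 2 * ((j : ℚ) + 1) + 1) /
          (((j : ℚ) + 1) * (2 * (k : ℚ) - ((j : ℚ) + 1)))) / vRat k (j + 1)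

/-- Finite continued fraction `[a_1, …, a_n] = a_1 + 1/[a_2, …, a_n]`. -/
def cfl {K : Type*} [DivisionRing K] : List K → K
  | [] => 0
  | [a] => a
  | a :: b :: t => a + (cfl (b :: t))⁻¹

/-- The coefficients `b_i = (-1)^(k-1-i) C(k-1,i) (2i+1)⁻¹` of `Q_k`. -/
def bRat (k i : ℕ) : ℚ := (-1) ^ (k - 1 - i) * (Nat.choose (k - 1) i : ℚ) * (2 * (i : ℚ) + 1)⁻¹

/-- `k ∈ E(r)` for `r = p^t`: `k = m p^l + (p^l - 1)/2`, `1 ≤ m ≤ (p-1)/2`, `0 ≤ l ≤ t-1`. -/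
def memE (p t k : ℕ) : Prop :=
  ∃ m l : ℕ, 1 ≤ m ∧ m ≤ (p - 1) / 2 ∧ l ≤ t - 1 ∧ k = m * p ^ l + (p ^ l - 1) / 2

/-- The sequence `δ 0 = 0`, `δ 1 = 1`, `δ (i+2) = v (i+1) + δ i`. -/
def partialDelta {R : Type*} [Ring R] (v : ℕ → R) : ℕ → R
  | 0 => 0
  | 1 => 1
  | i + 2 => v (i + 1) + partialDelta v i

lemma exists_backward_recurrence {A : Type*} [Semiring A] (N : ℕ) (c : ℕ → A) :
    ∃ S : ℕ → A, S (N + 1) = 0 ∧ S N = 1 ∧ ∀ i < N, S i = c i * S (i + 1) + S (i + 2) := by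
  induction N generalizing c with
  | zero => exact ⟨fun i => if i = 0 then 1 else 0, by simp⟩
  | succ N ih =>
    obtain ⟨S, h0, h1, h2⟩ := ih fun i => c (i + 1)
    refine ⟨fun i => Nat.casesOn i (c 0 * S 0 + S 1) S, h0, h1, fun i hi => ?_⟩
    cases i with
    | zero => rfl
    | succ i => exact h2 i (by omega)

lemma cfl_map_range' {K : Type*} [Field K] {N : ℕ} {f F : ℕ → K} (h0 : F (N + 1) = 0)
    (hne : ∀ i ≤ N, F i ≠ 0) (hF : ∀ i < N, F i = f i * F (i + 1) + F (i + 2)) (n : ℕ) :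
    ∀ i, i + (n + 1) = N → cfl ((List.range' i (n + 1)).map f) = F i / F (i + 1) := by
  induction n with
  | zero =>
    intro i hi
    have h := hF i (by omega)
    have e : i + 2 = N + 1 := by omega
    have h1 := hne (i + 1) (by omega)
    rw [e, h0, add_zero] at h
    simp [cfl, h, h1]
  | succ n ih =>
    intro i hi
    have h := ih (i + 1) (by omega)
    have h1 := hne (i + 1) (by omega)
    have h2 := hF i (by omega)
    rw [List.range'_succ, List.map_cons, List.range'_succ, List.map_cons, cfl, ← List.map_cons,
      ← List.range'_succ, h, h2]
    field_simp

lemma degree_of_backward_recurrence {K : Type*} [Field K] {N : ℕ} {c : ℕ → K} {S : ℕ → K[X]}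
    (h0 : S (N + 1) = 0) (h1 : S N = 1) (hc : ∀ i < N, c i ≠ 0)
    (hS : ∀ i < N, S i = C (c i) * X * S (i + 1) + S (i + 2)) (d : ℕ) :
    ∀ i, i + d = N → (S i).degree = d ∧ (S (i + 1)).degree < d := by
  induction d with
  | zero =>
    intro i hi
    obtain rfl : i = N := by omega
    simp [h0, h1]
  | succ d ih =>
    intro i hi
    obtain ⟨e1, e2⟩ := ih (i + 1) (by omega)
    have hlt : ((d : ℕ) : WithBot ℕ) < ((d + 1 : ℕ) : WithBot ℕ) := by
      exact_mod_cast Nat.lt_succ_self d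
    have e3 : (C (c i) * X * S (i + 1)).degree = ((d + 1 : ℕ) : WithBot ℕ) := by
      rw [degree_mul, degree_C_mul_X (hc i (by omega)), e1]
      push_cast
      exact add_comm _ _
    refine ⟨?_, e1 ▸ hlt⟩
    rw [hS i (by omega), degree_add_eq_left_of_degree_lt, e3]
    rw [e3]
    exact e2.trans hlt


lemma two_mul_sub_two_mul_sub_one_ne_zero {R : Type*} [CommRing R] [CharZero R] (k i : ℕ) :
    2 * (k : R) - 2 * (i : R) - 1 ≠ 0 := by
  have h : 2 * (k : ℤ) - 2 * (i : ℤ) - 1 ≠ 0 := by omega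
  exact_mod_cast (Int.cast_ne_zero (α := R)).mpr h

section

variable {R : Type*} [CommRing R] [IsDomain R] [CharZero R]

lemma partialDelta_mul {k : ℕ} {v : ℕ → R} (h1 : v 1 = 2 * k - 1)
    (hv : ∀ i : ℕ, 1 ≤ i → i < 2 * k →
      v (i + 1) * v i * (i * (2 * k - i)) = (2 * k - 2 * i - 1) * (2 * k - 2 * i + 1)) (i : ℕ) :
    i < 2 * k → partialDelta v (i + 1) * v (i + 1) = 2 * k - 2 * i - 1 ∧
      partialDelta v (i + 1) * partialDelta v i = i * (2 * k - i) := by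
  induction i with
  | zero => intro _; simp [partialDelta, h1]
  | succ i ih =>
    intro hi
    obtain ⟨e1, e2⟩ := ih (by omega)
    have hd : partialDelta v (i + 2) = v (i + 1) + partialDelta v i := rfl
    have e3 : partialDelta v (i + 2) * partialDelta v (i + 1) =
        ((i + 1 : ℕ) : R) * (2 * k - ((i + 1 : ℕ) : R)) := by
      rw [hd]; push_cast; linear_combination e1 + e2
    refine ⟨mul_right_cancel₀ (two_mul_sub_two_mul_sub_one_ne_zero k i) ?_, e3⟩
    have := hv (i + 1) (by omega) hi
    rw [← e3] at this
    push_cast at this ⊢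
    linear_combination this - partialDelta v (i + 2) * v (i + 2) * e1

lemma partialDelta_two_mul_add_one {k : ℕ} (hk : 1 ≤ k) {v : ℕ → R} (h1 : v 1 = 2 * k - 1)
    (hv : ∀ i : ℕ, 1 ≤ i → i < 2 * k →
      v (i + 1) * v i * (i * (2 * k - i)) = (2 * k - 2 * i - 1) * (2 * k - 2 * i + 1)) :
    partialDelta v (2 * k + 1) = 0 := by
  obtain ⟨n, hn⟩ : ∃ n, 2 * k = n + 1 := ⟨2 * k - 1, by omega⟩
  obtain ⟨e1, e2⟩ := partialDelta_mul h1 hv n (by omega)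
  have hk2 : (2 * k : R) = n + 1 := by exact_mod_cast congrArg (Nat.cast (R := R)) hn
  have hne : partialDelta v (n + 1) ≠ 0 := fun h => by
    rw [h, zero_mul] at e1
    exact two_mul_sub_two_mul_sub_one_ne_zero (R := R) k n e1.symm
  have hd : partialDelta v (n + 2) = v (n + 1) + partialDelta v n := rfl
  rw [hn]
  refine mul_right_cancel₀ hne ?_
  rw [hd]
  linear_combination e1 + e2 + (n + 1 : R) * hk2

lemma eq_zero_of_sq_sub_one_mul_derivative {g : R[X]} {a : R}
    (hg : (X ^ 2 - 1) * derivative g = C a * X * g) (h0 : g.coeff 0 = 0) : g = 0 := by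
  ext n
  rw [coeff_zero]
  induction n using Nat.strong_induction_on with
  | _ n ih =>
    match n with
    | 0 => exact h0
    | 1 =>
      have := congrArg (fun q => coeff q 0) hg
      simpa [sub_mul, mul_assoc, coeff_derivative, mul_coeff_zero] using this
    | n + 2 =>
      have := congrArg (fun q => coeff q (n + 1)) hg
      have hn := ih n (by omega)
      have h2 : ((n : R) + 1 + 1) ≠ 0 := by exact_mod_cast Nat.succ_ne_zero (n + 1)
      have e : (X ^ 2 * derivative g).coeff (n + 1) = n * g.coeff n := by
        cases n with
        | zero => simp [coeff_X_pow_mul']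
        | succ n =>
          rw [coeff_X_pow_mul g.derivative 2 n, coeff_derivative]
          push_cast; ring
      rw [sub_mul, coeff_sub, e, one_mul, coeff_derivative, mul_assoc, coeff_C_mul, coeff_X_mul,
        hn] at this
      simpa [h2] using this

/-- The tails of the continued fraction satisfy a first-order differential system. -/
lemma backward_recurrence_differential_system {k : ℕ} (hk : 1 ≤ k) {v : ℕ → R}
    (h1 : v 1 = 2 * k - 1)
    (hv : ∀ i : ℕ, 1 ≤ i → i < 2 * k →
      v (i + 1) * v i * (i * (2 * k - i)) = (2 * k - 2 * i - 1) * (2 * k - 2 * i + 1))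
    {S : ℕ → R[X]} (hS0 : S (2 * k + 1) = 0) (hS1 : S (2 * k) = 1)
    (hS : ∀ i < 2 * k, S i = C (v (i + 1)) * X * S (i + 1) + S (i + 2)) (d : ℕ) :
    ∀ i, i + d = 2 * k →
      (X ^ 2 - 1) * derivative (S i) =
          (2 * (k : R[X]) - (i : R[X])) * X * S i + C (partialDelta v i) * S (i + 1) ∧
        (X ^ 2 - 1) * derivative (S (i + 1)) =
          (i : R[X]) * X * S (i + 1) + C (partialDelta v (i + 1)) * S i := by
  induction d with
  | zero =>
    intro i hi
    obtain rfl : i = 2 * k := by omega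
    simp [hS0, hS1, partialDelta_two_mul_add_one hk h1 hv]
  | succ d ih =>
    intro i hi
    obtain ⟨e1, e2⟩ := ih (i + 1) (by omega)
    have hd : C (partialDelta v (i + 2)) = C (v (i + 1)) + C (partialDelta v i) := by
      rw [← C_add]; rfl
    have hdv : C (partialDelta v (i + 1)) * C (v (i + 1)) = 2 * (k : R[X]) - 2 * i - 1 := by
      rw [← C_mul, (partialDelta_mul h1 hv i (by omega)).1]
      simp [C_ofNat]
    have hr := hS i (by omega)
    have e3 : (X ^ 2 - 1) * derivative (S (i + 1)) =
        (i : R[X]) * X * S (i + 1) + C (partialDelta v (i + 1)) * S i := by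
      rw [e1, hr]; push_cast; linear_combination (-X * S (i + 1)) * hdv
    refine ⟨?_, e3⟩
    have hder : derivative (S i) = C (v (i + 1)) * S (i + 1) +
        C (v (i + 1)) * X * derivative (S (i + 1)) + derivative (S (i + 2)) := by
      rw [hr]; simp
    rw [hder]
    rw [hd] at e2
    push_cast at e2
    linear_combination (C (v (i + 1)) * X) * e3 + e2 + (X * S i) * hdv -
      ((i + 1 : R[X]) * X) * hr

theorem backward_recurrence_eq {k : ℕ} (hk : 1 ≤ k) {v : ℕ → R} (h1 : v 1 = 2 * k - 1)
    (hv : ∀ i : ℕ, 1 ≤ i → i < 2 * k →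
      v (i + 1) * v i * (i * (2 * k - i)) = (2 * k - 2 * i - 1) * (2 * k - 2 * i + 1))
    {S : ℕ → R[X]} (hS0 : S (2 * k + 1) = 0) (hS1 : S (2 * k) = 1)
    (hS : ∀ i < 2 * k, S i = C (v (i + 1)) * X * S (i + 1) + S (i + 2)) :
    S 0 = (-1) ^ k * (X ^ 2 - 1) ^ k ∧ derivative (S 1) = (-1) ^ k * (X ^ 2 - 1) ^ (k - 1) ∧
      (S 1).coeff 0 = 0 := by
  obtain ⟨e1, e2⟩ :=
    backward_recurrence_differential_system hk h1 hv hS0 hS1 hS (2 * k) 0 (by omega)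
  have hc : ∀ d, d ≤ k → (S (2 * (k - d))).coeff 0 = 1 ∧ (S (2 * (k - d) + 1)).coeff 0 = 0 := by
    intro d
    induction d with
    | zero => simp [hS0, hS1]
    | succ d ih =>
      intro hd
      obtain ⟨c1, c2⟩ := ih (by omega)
      have e : 2 * (k - d) = 2 * (k - (d + 1)) + 2 := by omega
      rw [e] at c1 c2
      rw [hS _ (by omega), hS (2 * (k - (d + 1)) + 1) (by omega)]
      simp [mul_coeff_zero, c1, c2]
  obtain ⟨c0, c1⟩ := hc k le_rfl
  simp only [Nat.sub_self, mul_zero, zero_add] at c0 c1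
  have hP : (X ^ 2 - 1 : R[X]) * derivative ((X ^ 2 - 1) ^ k) =
      2 * (k : R[X]) * X * (X ^ 2 - 1) ^ k := by
    obtain ⟨n, rfl⟩ : ∃ n, k = n + 1 := ⟨k - 1, by omega⟩
    simp [derivative_pow, C_ofNat]
    ring
  have hne : (X ^ 2 - 1 : R[X]) ≠ 0 := by
    simpa using X_pow_sub_C_ne_zero (R := R) (n := 2) (by norm_num) 1
  have hz : S 0 = (-1) ^ k * (X ^ 2 - 1) ^ k := by
    rw [← sub_eq_zero]
    refine eq_zero_of_sq_sub_one_mul_derivative (a := 2 * k) ?_ ?_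
    · have hm : derivative ((-1 : R[X]) ^ k * (X ^ 2 - 1) ^ k) =
          (-1) ^ k * derivative ((X ^ 2 - 1) ^ k) := by
        rw [show (-1 : R[X]) ^ k = C ((-1) ^ k) by simp, derivative_C_mul]
      simp only [partialDelta, C_0, zero_mul, add_zero, Nat.cast_zero, sub_zero] at e1
      rw [derivative_sub, hm, C_mul, C_ofNat, C_eq_natCast]
      linear_combination e1 - (-1) ^ k * hP
    · rw [coeff_sub, c0, coeff_zero_eq_eval_zero]
      simp [← mul_pow]
  refine ⟨hz, mul_left_cancel₀ hne ?_, c1⟩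
  simp only [partialDelta, C_1, one_mul, zero_add, Nat.cast_zero, zero_mul] at e2
  rw [e2, hz]
  obtain ⟨n, rfl⟩ : ∃ n, k = n + 1 := ⟨k - 1, by omega⟩
  simp only [Nat.add_sub_cancel]
  ring

end

lemma Padic.norm_natCast_mul_pow_sub_eq {p : ℕ} [Fact p.Prime] (hodd : p ≠ 2) {m l i c : ℕ}
    (hm : 2 * m + 1 ≤ p) (hc : c = 1 ∨ c = 2) (hi : 1 ≤ i) (hi' : i < (2 * m + 1) * p ^ l) :
    ‖((2 * m + 1 : ℕ) * (p : ℚ_[p]) ^ l - c * i)‖ = ‖(i : ℚ_[p])‖ := by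
  have hp : p.Prime := Fact.out
  obtain ⟨n, u, hu, rfl⟩ := Nat.exists_eq_pow_mul_and_not_dvd (by omega : i ≠ 0) p hp.ne_one
  have hcu : ¬ (p : ℤ) ∣ c * u := by
    intro h
    have h' : p ∣ c * u := by exact_mod_cast h
    rcases (hp.dvd_mul).1 h' with h | h
    · have := Nat.le_of_dvd (by omega) h
      have := hp.two_le
      omega
    · exact hu h
  have hnl : n ≤ l := by
    by_contra! hlt
    have h1 : p ^ (l + 1) ≤ p ^ n := Nat.pow_le_pow_right hp.pos hlt
    have h2 : p ^ n ≤ p ^ n * u :=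
      Nat.le_mul_of_pos_right _ (Nat.pos_of_ne_zero (by rintro rfl; simp at hu))
    have h3 : (2 * m + 1) * p ^ l ≤ p * p ^ l := Nat.mul_le_mul_right _ hm
    rw [pow_succ'] at h1
    omega
  obtain ⟨e, rfl⟩ := Nat.exists_eq_add_of_le hnl
  have hw : ¬ (p : ℤ) ∣ (2 * m + 1) * p ^ e - c * u := by
    intro h
    cases e with
    | succ e =>
      exact hcu ((dvd_sub_right (Dvd.intro_left ((2 * m + 1 : ℤ) * p ^ e) (by ring))).1 h)
    | zero =>
      have hlt : u < 2 * m + 1 := by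
        rw [add_zero, mul_comm] at hi'
        exact lt_of_mul_lt_mul_right hi' (Nat.zero_le _)
      have hu0 : u ≠ 0 := by rintro rfl; simp at hu
      rw [pow_zero, mul_one] at h
      rcases hm.lt_or_eq with hm | hm
      · have := Int.eq_zero_of_abs_lt_dvd h (by
          rcases hc with rfl | rfl <;> rw [abs_lt] <;> push_cast <;> constructor <;> omega)
        rcases hc with rfl | rfl <;> push_cast at this <;> omega
      · have hm' : (2 * m + 1 : ℤ) = p := by exact_mod_cast hm
        rw [hm'] at h
        exact hcu ((dvd_sub_right dvd_rfl).1 h)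
  have hwn := Padic.norm_intCast_lt_one_iff (p := p) (k := (2 * m + 1) * p ^ e - c * u)
  have hun := Padic.norm_intCast_lt_one_iff (p := p) (k := u)
  have h1 : ‖(((2 * m + 1) * p ^ e - c * u : ℤ) : ℚ_[p])‖ = 1 :=
    le_antisymm (Padic.norm_int_le_one _) (not_lt.1 fun h => hw (hwn.1 h))
  have h2 : ‖((u : ℤ) : ℚ_[p])‖ = 1 :=
    le_antisymm (Padic.norm_int_le_one _)
      (not_lt.1 fun h => hu (by exact_mod_cast hun.1 h))
  have h3 : ((2 * m + 1 : ℕ) * (p : ℚ_[p]) ^ (n + e) - c * (p ^ n * u : ℕ)) =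
      p ^ n * (((2 * m + 1) * p ^ e - c * u : ℤ) : ℚ_[p]) := by
    push_cast; ring
  have h4 : ((p ^ n * u : ℕ) : ℚ_[p]) = p ^ n * ((u : ℤ) : ℚ_[p]) := by push_cast; ring
  rw [h3, h4, norm_mul, norm_mul, h1, h2]

lemma PadicInt.toZMod_eq_ratCast {p : ℕ} [Fact p.Prime] {q : ℚ} {z : ℤ_[p]}
    (h : (z : ℚ_[p]) = q) : toZMod z = (q : ZMod p) := by
  have hd0 : (q.den : ZMod p) ≠ 0 := by
    simpa using ((isUnit_den q (h ▸ z.norm_le_one)).map PadicInt.toZMod).ne_zero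
  have hz : z * (q.den : ℤ_[p]) = (q.num : ℤ_[p]) := by
    apply PadicInt.ext
    push_cast
    rw [h]
    exact_mod_cast congrArg (Rat.cast (K := ℚ_[p])) (Rat.mul_den_eq_num q)
  have := congrArg PadicInt.toZMod hz
  rw [map_mul, map_natCast, map_intCast] at this
  rw [Rat.cast_def, eq_div_iff hd0, this]

lemma norm_vRat {p m l k : ℕ} [Fact p.Prime] (hodd : p ≠ 2) (hk : 1 ≤ k) (hm : 2 * m + 1 ≤ p)
    (hkm : 2 * k + 1 = (2 * m + 1) * p ^ l) (i : ℕ) (hi : i < 2 * k) :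
    ‖(vRat k (i + 1) : ℚ_[p])‖ = 1 := by
  have hcast : ((2 * m + 1 : ℕ) * (p : ℚ_[p]) ^ l) = 2 * k + 1 := by exact_mod_cast hkm.symm
  have key : ∀ c i : ℕ, c = 1 ∨ c = 2 → 1 ≤ i → i ≤ 2 * k →
      ‖(2 * k + 1 - c * i : ℚ_[p])‖ = ‖(i : ℚ_[p])‖ := fun c i hc h1 h2 => by
    rw [← hcast]
    exact Padic.norm_natCast_mul_pow_sub_eq hodd hm hc h1 (by omega)
  induction i with
  | zero =>
    have := key 2 1 (Or.inr rfl) le_rfl (by omega)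
    rw [Nat.cast_one, norm_one] at this
    rw [← this, vRat]
    push_cast
    congr 1
    ring
  | succ i ih =>
    have h1 := key 2 (i + 1) (Or.inr rfl) (by omega) (by omega)
    have h2 := key 2 (i + 2) (Or.inr rfl) (by omega) (by omega)
    have h3 := key 1 (i + 2) (Or.inl rfl) (by omega) (by omega)
    have n1 : ‖((i + 1 : ℕ) : ℚ_[p])‖ ≠ 0 := by
      rw [norm_ne_zero_iff]; exact_mod_cast Nat.succ_ne_zero i
    have n2 : ‖((i + 2 : ℕ) : ℚ_[p])‖ ≠ 0 := by
      rw [norm_ne_zero_iff]; exact_mod_cast Nat.succ_ne_zero (i + 1)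
    have e : (vRat k (i + 2) : ℚ_[p]) =
        (2 * k + 1 - (2 : ℕ) * (i + 2 : ℕ)) * (2 * k + 1 - (2 : ℕ) * (i + 1 : ℕ)) /
          ((i + 1 : ℕ) * (2 * k + 1 - (1 : ℕ) * (i + 2 : ℕ))) / vRat k (i + 1) := by
      rw [vRat]
      push_cast
      ring_nf
    rw [e, norm_div, norm_div, norm_mul, norm_mul, h1, h2, h3, ih (by omega), div_one,
      mul_comm ‖((i + 1 : ℕ) : ℚ_[p])‖]
    exact div_self (mul_ne_zero n2 n1)

lemma vRat_mul_vRat {k i : ℕ} (hi : 1 ≤ i) (hik : i < 2 * k) (h0 : vRat k i ≠ 0) :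
    vRat k (i + 1) * vRat k i * (i * (2 * k - i)) = (2 * k - 2 * i - 1) * (2 * k - 2 * i + 1) := by
  obtain ⟨j, rfl⟩ : ∃ j, i = j + 1 := ⟨i - 1, by omega⟩
  have h1 : (j : ℚ) + 1 ≠ 0 := by positivity
  have h2 : 2 * (k : ℚ) - (j + 1) ≠ 0 := by
    have : (j : ℚ) + 1 < 2 * k := by exact_mod_cast hik
    linarith
  rw [vRat]
  push_cast
  field_simp

lemma coeff_eq_of_derivative_eq {R : Type*} [CommRing R] {k : ℕ} {f : R[X]}
    (hf : derivative f = (-1) ^ k * (X ^ 2 - 1) ^ (k - 1)) (i : ℕ) :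
    f.coeff (2 * i + 1) * ((2 * i + 1 : ℕ) : R) =
      (-1) ^ k * ((-1) ^ (k - 1 - i) * (Nat.choose (k - 1) i : R)) := by
  have h := congrArg (fun q => coeff q (2 * i)) hf
  have e : (-1 : R[X]) ^ k * (X ^ 2 - 1) ^ (k - 1) =
      C ((-1) ^ k) * expand R 2 ((X + C (-1)) ^ (k - 1)) := by
    simp [sub_eq_add_neg]
  simp only [e, coeff_derivative, coeff_C_mul] at h
  rw [mul_comm 2 i, coeff_expand_mul (by norm_num), coeff_X_add_C_pow] at h
  rw [mul_comm 2 i, ← h]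
  push_cast
  ring

lemma eq_sum_of_derivative_eq {R : Type*} [CommRing R] [IsDomain R] [CharZero R] {k : ℕ}
    (hk : 1 ≤ k) {f : R[X]} (hf : derivative f = (-1) ^ k * (X ^ 2 - 1) ^ (k - 1))
    (h0 : f.coeff 0 = 0) :
    f = ∑ i ∈ Finset.range k, C (f.coeff (2 * i + 1)) * X ^ (2 * i + 1) := by
  rw [← sub_eq_zero]
  set g := f - ∑ i ∈ Finset.range k, C (f.coeff (2 * i + 1)) * X ^ (2 * i + 1) with hg
  have hd : derivative g = 0 := by
    have e : (X ^ 2 - 1 : R[X]) ^ (k - 1) =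
        ∑ i ∈ Finset.range k, C ((-1) ^ (k - 1 - i) * (Nat.choose (k - 1) i : R)) * X ^ (2 * i) := by
      rw [sub_eq_add_neg, add_pow, Nat.sub_add_cancel hk]
      refine Finset.sum_congr rfl fun i _ => ?_
      simp [pow_mul]
      ring
    rw [hg, derivative_sub, hf, e, derivative_sum, Finset.mul_sum, ← Finset.sum_sub_distrib]
    refine Finset.sum_eq_zero fun i _ => ?_
    have := congrArg (C (R := R)) (coeff_eq_of_derivative_eq hf i)
    rw [derivative_C_mul_X_pow, Nat.add_sub_cancel]
    rw [this]
    simp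
    ring
  rw [eq_C_of_natDegree_eq_zero (derivative_eq_zero.1 hd), hg, coeff_sub, h0,
    coeff_zero_eq_eval_zero]
  simp [eval_finsetSum]

/-- Let `p` be an odd prime, `r = p^t`, `k ∈ E(r)`. The rationals `b_i` have nonnegative
`p`-adic valuation, the reductions `v̄_{i,k} ∈ F_p` are nonzero, and with
`P_k = (T²-1)^k`, `Q_k = Σ b̄_i T^(2i+1)` in `F_p[T]`, one has
`P_k/Q_k = [v̄_{1,k} T, …, v̄_{2k,k} T]` in `F_p(T)`. -/
theorem statement5 (p t : ℕ) [Fact p.Prime] (hodd : p ≠ 2) (ht : 1 ≤ t)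
    (k : ℕ) (hk : memE p t k) :
    (∀ i, i < k → 0 ≤ padicValRat p (bRat k i)) ∧
    (∀ i, 1 ≤ i → i ≤ 2 * k → ((vRat k i : ZMod p)) ≠ 0) ∧
    algebraMap (Polynomial (ZMod p)) (RatFunc (ZMod p)) ((X ^ 2 - 1) ^ k) /
        algebraMap (Polynomial (ZMod p)) (RatFunc (ZMod p))
          (∑ i ∈ Finset.range k, Polynomial.C ((bRat k i : ZMod p)) * X ^ (2 * i + 1)) =
      cfl ((List.range (2 * k)).map fun i =>
        RatFunc.C ((vRat k (i + 1) : ZMod p)) * RatFunc.X) := by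
  obtain ⟨m, l, hm1, hm2, -, hkm⟩ := hk
  have hp : p.Prime := Fact.out
  have hp2 := hp.odd_of_ne_two hodd
  have hkm' : 2 * k + 1 = (2 * m + 1) * p ^ l := by
    obtain ⟨c, hc⟩ := hp2.pow (n := l)
    rw [hkm, hc, Nat.add_sub_cancel, Nat.mul_div_cancel_left _ two_pos]
    ring
  have hm : 2 * m + 1 ≤ p := by
    obtain ⟨c, rfl⟩ := hp2
    omega
  have hk1 : 1 ≤ k := by
    have : 0 < m * p ^ l := Nat.mul_pos hm1 (pow_pos hp.pos l)
    omega
  have hnorm := norm_vRat hodd hk1 hm hkm'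
  have hex : ∀ i, ∃ z : ℤ_[p], 1 ≤ i → i ≤ 2 * k → (z : ℚ_[p]) = vRat k i ∧ ‖z‖ = 1 := fun i => by
    by_cases hi : 1 ≤ i ∧ i ≤ 2 * k
    · obtain ⟨j, rfl⟩ : ∃ j, i = j + 1 := ⟨i - 1, by omega⟩
      have h := hnorm j (by omega)
      exact ⟨⟨vRat k (j + 1), h.le⟩, fun _ _ => ⟨rfl, h⟩⟩
    · exact ⟨0, fun h1 h2 => absurd ⟨h1, h2⟩ hi⟩
  choose v hv using hex
  have hvmod : ∀ i, 1 ≤ i → i ≤ 2 * k → PadicInt.toZMod (v i) = (vRat k i : ZMod p) :=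
    fun i h1 h2 => PadicInt.toZMod_eq_ratCast (hv i h1 h2).1
  have hvne : ∀ i, 1 ≤ i → i ≤ 2 * k → (vRat k i : ZMod p) ≠ 0 := fun i h1 h2 => by
    rw [← hvmod i h1 h2]
    exact ((PadicInt.isUnit_iff.2 (hv i h1 h2).2).map PadicInt.toZMod).ne_zero
  have hv1 : v 1 = 2 * k - 1 := by
    apply PadicInt.ext
    rw [(hv 1 le_rfl (by omega)).1, vRat]
    push_cast
    rfl
  have hvv : ∀ i : ℕ, 1 ≤ i → i < 2 * k →
      v (i + 1) * v i * (i * (2 * k - i)) = (2 * k - 2 * i - 1) * (2 * k - 2 * i + 1) := by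
    intro i h1 h2
    have h0 : vRat k i ≠ 0 := fun h => hvne i h1 h2.le (by rw [h, Rat.cast_zero])
    have h := congrArg (Rat.cast (K := ℚ_[p])) (vRat_mul_vRat h1 h2 h0)
    apply PadicInt.ext
    push_cast at h ⊢
    rw [(hv i h1 h2.le).1, (hv (i + 1) (by omega) h2).1]
    exact h
  obtain ⟨S, hS0, hS1, hS⟩ :=
    exists_backward_recurrence (2 * k) fun i => (C (v (i + 1)) * X : ℤ_[p][X])
  obtain ⟨hP, hQ, hQ0⟩ := backward_recurrence_eq hk1 hv1 hvv hS0 hS1 hS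
  have hb : ∀ i, (((-1) ^ k * (S 1).coeff (2 * i + 1) : ℤ_[p]) : ℚ_[p]) = bRat k i := by
    intro i
    have h := congrArg (fun z : ℤ_[p] => (z : ℚ_[p])) (coeff_eq_of_derivative_eq hQ i)
    have h2 : ((2 * i + 1 : ℕ) : ℚ_[p]) ≠ 0 := Nat.cast_ne_zero.2 (Nat.succ_ne_zero (2 * i))
    have h3 : ((-1) ^ k * (-1) ^ k : ℚ_[p]) = 1 := by simp [← mul_pow]
    have hb' : (bRat k i : ℚ_[p]) = (-1) ^ (k - 1 - i) * (Nat.choose (k - 1) i : ℚ_[p]) *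
        ((2 * i + 1 : ℕ) : ℚ_[p])⁻¹ := by
      rw [bRat]; push_cast; rfl
    simp only [PadicInt.coe_mul, PadicInt.coe_pow, PadicInt.coe_neg, PadicInt.coe_one,
      PadicInt.coe_natCast] at h ⊢
    rw [hb', eq_mul_inv_iff_mul_eq₀ h2, mul_assoc, h, ← mul_assoc, h3, one_mul]
  refine ⟨fun i _ => ?_, hvne, ?_⟩
  · have h : ‖(bRat k i : ℚ_[p])‖ ≤ 1 := hb i ▸ PadicInt.norm_le_one _
    rwa [Padic.norm_le_one_iff_val_nonneg, Padic.valuation_ratCast] at h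
  set φ : ℤ_[p][X] →+* (ZMod p)[X] := mapRingHom PadicInt.toZMod with hφ
  set ψ := algebraMap (ZMod p)[X] (RatFunc (ZMod p)) with hψ
  have hrec : ∀ i < 2 * k, φ (S i) =
      C (vRat k (i + 1) : ZMod p) * X * φ (S (i + 1)) + φ (S (i + 2)) := fun i hi => by
    rw [hS i hi, map_add, map_mul, ← hvmod (i + 1) (by omega) hi]
    simp [hφ]
  have hne : ∀ i ≤ 2 * k, ψ (φ (S i)) ≠ 0 := fun i hi => by
    have h := (degree_of_backward_recurrence (S := fun i => φ (S i)) (by simp [hS0])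
      (by simp [hS1]) (fun i hi => hvne (i + 1) (by omega) hi) hrec (2 * k - i) i (by omega)).1
    rw [hψ, Ne, FaithfulSMul.algebraMap_eq_zero_iff]
    intro h0
    simp [h0] at h
  have hP' : φ (S 0) = (-1) ^ k * (X ^ 2 - 1) ^ k := by
    rw [hP]; simp [hφ]
  have hQ' : φ (S 1) = (-1) ^ k *
      ∑ i ∈ Finset.range k, C ((bRat k i : ZMod p)) * X ^ (2 * i + 1) := by
    rw [eq_sum_of_derivative_eq hk1 hQ hQ0, map_sum, Finset.mul_sum]
    refine Finset.sum_congr rfl fun i _ => ?_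
    rw [← PadicInt.toZMod_eq_ratCast (hb i)]
    have h3 : ((-1) ^ k * (-1) ^ k : (ZMod p)[X]) = 1 := by simp [← mul_pow]
    simp only [hφ, coe_mapRingHom, map_C, map_X, map_mul, map_pow,
      map_neg, map_one]
    rw [← mul_assoc, ← mul_assoc, h3, one_mul]
  have hcf := cfl_map_range' (N := 2 * k) (F := fun i => ψ (φ (S i)))
    (f := fun i => RatFunc.C (vRat k (i + 1) : ZMod p) * RatFunc.X) (by simp [hS0]) hne
    (fun i hi => by
      rw [hrec i hi, map_add, map_mul, map_mul, hψ, RatFunc.algebraMap_C, RatFunc.algebraMap_X])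
    (2 * k - 1) 0 (by omega)
  rw [Nat.sub_add_cancel (by omega), ← List.range_eq_range', zero_add] at hcf
  rw [hcf, hP', hQ', map_mul, map_mul, mul_div_mul_left]
  simp
end
end

section
/- Let p be an odd prime, q = p^s, r = p^t, k ∈ E(r), l ≥ 1, λ_1,…,λ_l ∈ F_q*, ε_1, ε_2 ∈ F_q*, and let α be the continued fraction of type (r,l,k) attached to these data, i.e. the unique root in F(q) with |α| ≥ |T| of the equation y_l X^{r+1} − x_l X^r + (ε_1P_k y_{l−1} − ε_2Q_k y_l)X − ε_1P_k x_{l−1} + ε_2Q_k x_l = 0. Then there exists a sequence (λ_n)_{n≥1} in F_q*, extending the given λ_1,…,λ_l, such that α is the value of the infinite continued fraction with partial quotients a_n = λ_n A_{i(n)} (its convergents converge to α in F(q)) if and only if there exist a sequence (λ_n)_{n≥1} in F_q* extending λ_1,…,λ_l and a sequence (δ_n)_{n≥0} in F_q* with δ_0 = −(ω_k ε_2)^{−1}, satisfying (D_1): δ_n = 2kθ_k^{i(n)} λ_n^r − (ω_k δ_{n−1})^{−1} for all n ≥ 1, and (LD): λ_{f(n)} = ε_1^{(−1)^n} λ_n^r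 and λ_{f(n)+i} = −v_{i,k} ε_1^{(−1)^{n+i}} δ_n^{(−1)^i} for all n ≥ 1 and 1 ≤ i ≤ 2k. -/
open Polynomial

noncomputable section

/-- `θ_k = (-1)^k 2^(-2k) C(2k,k)`. -/
def thetaRat (k : ℕ) : ℚ := (-1) ^ k * ((2 : ℚ) ^ (2 * k))⁻¹ * (Nat.choose (2 * k) k : ℚ)

/-- `ω_k = -(2kθ_k)⁻²`. -/
def omegaRat (k : ℕ) : ℚ := -((2 * (k : ℚ)) * thetaRat k)⁻¹ ^ 2

/-- Continuant numerators: `x_0 = 1`, `x_1 = a_1`, `x_n = a_n x_{n-1} + x_{n-2}`. -/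
def cnum {K : Type*} [Field K] (a : ℕ → K) : ℕ → K
  | 0 => 1
  | 1 => a 1
  | n + 2 => a (n + 2) * cnum a (n + 1) + cnum a n

/-- Continuant denominators: `y_0 = 0`, `y_1 = 1`, `y_n = a_n y_{n-1} + y_{n-2}`. -/
def cden {K : Type*} [Field K] (a : ℕ → K) : ℕ → K
  | 0 => 0
  | 1 => 1
  | n + 2 => a (n + 2) * cden a (n + 1) + cden a n

/-- The element `T` of `F(q) = F_q((T⁻¹))`, realized as the Laurent series
(in the variable `T⁻¹`) of order `-1`. -/
def Tvar (Fq : Type*) [Field Fq] : LaurentSeries Fq := HahnSeries.single (-1 : ℤ) 1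

/-- `P_k(T) = (T² - 1)^k` as an element of `F(q)`. -/
def PkLS (Fq : Type*) [Field Fq] (k : ℕ) : LaurentSeries Fq := (Tvar Fq ^ 2 - 1) ^ k

/-- `Q_k(T) = Σ_{i<k} b̄_i T^(2i+1)` as an element of `F(q)`, the coefficients being
the reductions mod `p` of the rationals `b_i` (`Fq` has characteristic `p`). -/
def QkLS (Fq : Type*) [Field Fq] (k : ℕ) : LaurentSeries Fq :=
  ∑ i ∈ Finset.range k, algebraMap Fq (LaurentSeries Fq) ((bRat k i : Fq)) * Tvar Fq ^ (2 * i + 1)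

/-- The partial quotients `λ_n T` in `F(q)`. -/
def aLin (Fq : Type*) [Field Fq] (lam : ℕ → Fq) (n : ℕ) : LaurentSeries Fq :=
  algebraMap Fq (LaurentSeries Fq) (lam n) * Tvar Fq

/-- The algebraic equation
`y_l X^(r+1) - x_l X^r + (ε₁ P_k y_{l-1} - ε₂ Q_k y_l) X - ε₁ P_k x_{l-1} + ε₂ Q_k x_l = 0`
defining a continued fraction of type `(r, l, k)`, where `x_n, y_n` are the continuants
of `[λ₁ T, …, λ_l T]`. -/
def CFtypeEqn (Fq : Type*) [Field Fq] (r k l : ℕ) (lam : ℕ → Fq) (e1 e2 : Fq)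
    (α : LaurentSeries Fq) : Prop :=
  cden (aLin Fq lam) l * α ^ (r + 1) - cnum (aLin Fq lam) l * α ^ r +
      (algebraMap Fq (LaurentSeries Fq) e1 * PkLS Fq k * cden (aLin Fq lam) (l - 1) -
        algebraMap Fq (LaurentSeries Fq) e2 * QkLS Fq k * cden (aLin Fq lam) l) * α -
      algebraMap Fq (LaurentSeries Fq) e1 * PkLS Fq k * cnum (aLin Fq lam) (l - 1) +
      algebraMap Fq (LaurentSeries Fq) e2 * QkLS Fq k * cnum (aLin Fq lam) l = 0

/-- `f(n) = (2k+1) n + l - 2k`. -/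
def fIdx (k l n : ℕ) : ℕ := (2 * k + 1) * n + l - 2 * k

/-- `i(n) = 1` if `n` is not of the form `f(m)` with `m ≥ 1`, and `i(f(n)) = i(n) + 1`
(for `k ≥ 1`, `l ≥ 1`, the unique `m ≥ 1` with `f(m) = n` is `(n + 2k - l)/(2k+1) < n`). -/
def iIdx (k l : ℕ) : ℕ → ℕ
  | n =>
    if h : 1 ≤ (n + 2 * k - l) / (2 * k + 1) ∧
        fIdx k l ((n + 2 * k - l) / (2 * k + 1)) = n ∧
        (n + 2 * k - l) / (2 * k + 1) < n then
      iIdx k l ((n + 2 * k - l) / (2 * k + 1)) + 1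
    else 1
  termination_by n => n
  decreasing_by exact h.2.2

/-- `A_1 = T`, `A_{i+1} = ⌊A_i^r / P_k⌋` where `P_k = (T²-1)^k` (Euclidean quotient). -/
def Aseq (K : Type*) [Field K] (r k : ℕ) : ℕ → Polynomial K
  | 0 => X
  | 1 => X
  | i + 2 => Aseq K r k (i + 1) ^ r / (X ^ 2 - 1) ^ k

/-- `θ_k` viewed in a field of characteristic `p` (reduction mod `p`). -/
def thF (Fq : Type*) [Field Fq] (k : ℕ) : Fq := (thetaRat k : Fq)

/-- `ω_k` viewed in a field of characteristic `p` (reduction mod `p`). -/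
def omF (Fq : Type*) [Field Fq] (k : ℕ) : Fq := (omegaRat k : Fq)

/-- `v_{i,k}` viewed in a field of characteristic `p` (reduction mod `p`). -/
def vF (Fq : Type*) [Field Fq] (k i : ℕ) : Fq := (vRat k i : Fq)

/-- The image in `F(q)` of a polynomial in `F_q[T]`. -/
def polyT (Fq : Type*) [Field Fq] (P : Polynomial Fq) : LaurentSeries Fq :=
  Polynomial.aeval (Tvar Fq) P

/-- The partial quotients `a_n = λ_n A_{i(n)}` viewed in `F(q)`. -/
def aPQ (Fq : Type*) [Field Fq] (r k l : ℕ) (lam : ℕ → Fq) (n : ℕ) : LaurentSeries Fq :=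
  algebraMap Fq (LaurentSeries Fq) (lam n) * polyT Fq (Aseq Fq r k (iIdx k l n))

/-- `α` is the value of the infinite continued fraction with partial quotients `a_n`:
the convergents `x_n/y_n` tend to `α` in the valuation topology of `F(q)`. -/
def ConvergesTo (Fq : Type*) [Field Fq] (a : ℕ → LaurentSeries Fq) (α : LaurentSeries Fq) :
    Prop :=
  Filter.Tendsto (fun n => cnum a n / cden a n) Filter.atTop (nhds α)

/-! ### Continued fractions over a valued field -/

section ContinuedFraction

variable {K : Type*} [Field K]

/-- The complete quotients of `α` with respect to the partial quotients `a 1, a 2, …`. -/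
def completeQuot (a : ℕ → K) (α : K) : ℕ → K
  | 0 => α
  | n + 1 => (completeQuot a α n - a (n + 1))⁻¹

lemma cnum_mul_cden_sub (a : ℕ → K) (n : ℕ) :
    cnum a (n + 1) * cden a n - cnum a n * cden a (n + 1) = (-1) ^ (n + 1) := by
  induction n with
  | zero => simp [cnum, cden]
  | succ n ih =>
    rw [cnum, cden, pow_succ, ← ih]
    ring

lemma cnum_congr {a b : ℕ → K} {n : ℕ} (h : ∀ j, 1 ≤ j → j ≤ n → a j = b j) :
    cnum a n = cnum b n := by
  induction n using Nat.twoStepInduction with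
  | zero => rfl
  | one => exact h 1 le_rfl le_rfl
  | more n ih1 ih2 =>
    rw [cnum, cnum, ih1 fun j h1 h2 => h j h1 (by omega), ih2 fun j h1 h2 => h j h1 (by omega),
      h (n + 2) (by omega) le_rfl]

lemma cden_congr {a b : ℕ → K} {n : ℕ} (h : ∀ j, 1 ≤ j → j ≤ n → a j = b j) :
    cden a n = cden b n := by
  induction n using Nat.twoStepInduction with
  | zero => rfl
  | one => rfl
  | more n ih1 ih2 =>
    rw [cden, cden, ih1 fun j h1 h2 => h j h1 (by omega), ih2 fun j h1 h2 => h j h1 (by omega),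
      h (n + 2) (by omega) le_rfl]

lemma completeQuot_add (a : ℕ → K) (α : K) (m n : ℕ) :
    completeQuot (fun j => a (m + j)) (completeQuot a α m) n = completeQuot a α (m + n) := by
  induction n with
  | zero => rfl
  | succ n ih => rw [completeQuot, ih, ← add_assoc, completeQuot, add_assoc]

lemma completeQuot_eq_add_inv (a : ℕ → K) (α : K) (n : ℕ) :
    completeQuot a α n = a (n + 1) + (completeQuot a α (n + 1))⁻¹ := by
  rw [completeQuot, inv_inv]
  ring

variable {Γ₀ : Type*} [LinearOrderedCommGroupWithZero Γ₀] (v : Valuation K Γ₀)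

lemma valuation_inv_lt_one {τ : Γ₀} (hτ : 1 < τ) {y : K} (hy : τ ≤ v y) : v y⁻¹ < 1 := by
  rw [map_inv₀]
  exact inv_lt_one_of_one_lt₀ (hτ.trans_le hy)

lemma ne_zero_of_le_valuation {τ : Γ₀} (hτ : 1 < τ) {y : K} (hy : τ ≤ v y) : y ≠ 0 := by
  rintro rfl
  rw [map_zero] at hy
  exact absurd (hτ.trans_le hy) (not_lt.2 zero_le_one)

lemma valuation_add_inv {τ : Γ₀} (hτ : 1 < τ) {x y : K} (hx : τ ≤ v x) (hy : τ ≤ v y) :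
    v (x + y⁻¹) = v x :=
  Valuation.map_add_eq_of_lt_left v
    ((valuation_inv_lt_one v hτ hy).trans (hτ.trans_le hx))

/-- If `α = [a 1, …, a (h+1), y]` with large entries, then `y` is the complete quotient of `α`. -/
lemma completeQuot_of_mobius {τ : Γ₀} (hτ : 1 < τ) (a : ℕ → K) (α : K) (h : ℕ) (y : K)
    (ha : ∀ j, 1 ≤ j → j ≤ h + 1 → τ ≤ v (a j)) (hy : τ ≤ v y)
    (hα : α * (cden a (h + 1) * y + cden a h) = cnum a (h + 1) * y + cnum a h) :
    completeQuot a α (h + 1) = y ∧ ∀ i ≤ h + 1, τ ≤ v (completeQuot a α i) := by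
  induction h generalizing y with
  | zero =>
    have hy0 := ne_zero_of_le_valuation v hτ hy
    simp only [cden, cnum, one_mul, add_zero] at hα
    have e : α = a 1 + y⁻¹ := by
      field_simp
      exact hα
    have e1 : completeQuot a α 1 = y := by
      simp [completeQuot, e]
    refine ⟨e1, fun i hi => ?_⟩
    obtain rfl | rfl : i = 0 ∨ i = 1 := by omega
    · rw [completeQuot, e, valuation_add_inv v hτ (ha 1 le_rfl le_rfl) hy]
      exact ha 1 le_rfl le_rfl
    · rw [e1]
      exact hy
  | succ h ih =>
    have hy0 := ne_zero_of_le_valuation v hτ hy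
    have hz : τ ≤ v (a (h + 2) + y⁻¹) := by
      rw [valuation_add_inv v hτ (ha _ (by omega) le_rfl) hy]
      exact ha _ (by omega) le_rfl
    obtain ⟨e, hi⟩ := ih (a (h + 2) + y⁻¹) (fun j h1 h2 => ha j h1 (by omega)) hz (by
      rw [cden, cnum] at hα
      field_simp
      linear_combination hα)
    have e1 : completeQuot a α (h + 2) = y := by
      rw [completeQuot, e]
      simp
    refine ⟨e1, fun i hi' => ?_⟩
    obtain h1 | rfl : i ≤ h + 1 ∨ i = h + 2 := by omega
    · exact hi i h1
    · rw [e1]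
      exact hy

lemma mobius_completeQuot (a : ℕ → K) (α : K) (h : ℕ)
    (h0 : ∀ i, 1 ≤ i → i ≤ h + 1 → completeQuot a α i ≠ 0) :
    α * (cden a (h + 1) * completeQuot a α (h + 1) + cden a h) =
      cnum a (h + 1) * completeQuot a α (h + 1) + cnum a h := by
  induction h with
  | zero =>
    have h1 := h0 1 le_rfl le_rfl
    have e : α = _ := completeQuot_eq_add_inv a α 0
    simp only [zero_add] at e
    simp only [cden, cnum, zero_add, one_mul, add_zero]
    field_simp at e
    exact e
  | succ h ih =>
    have h1 := h0 (h + 2) (by omega) le_rfl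
    have e := completeQuot_eq_add_inv a α (h + 1)
    have := ih fun i h1 h2 => h0 i h1 (by omega)
    rw [e] at this
    rw [cden, cnum]
    field_simp at this
    linear_combination this

/-- Uniqueness of continued fraction expansions with separated partial quotients. -/
lemma eq_of_mobius {τ : Γ₀} (hτ : 1 < τ) (a b : ℕ → K) (α : K) (h : ℕ) (y : K)
    (hb : ∀ j, 1 ≤ j → j ≤ h + 1 → τ ≤ v (b j)) (hy : τ ≤ v y)
    (hα : α * (cden b (h + 1) * y + cden b h) = cnum b (h + 1) * y + cnum b h)
    (ha : ∀ i, i ≤ h + 1 → τ ≤ v (completeQuot a α i))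
    (hab : ∀ j, 1 ≤ j → j ≤ h + 1 → v (a j - b j) < 1 → a j = b j) :
    (∀ j, 1 ≤ j → j ≤ h + 1 → a j = b j) ∧ completeQuot a α (h + 1) = y := by
  obtain ⟨e, hi⟩ := completeQuot_of_mobius v hτ b α h y hb hy hα
  have key : ∀ i ≤ h + 1, completeQuot a α i = completeQuot b α i ∧ (1 ≤ i → a i = b i) := by
    intro i
    induction i with
    | zero => simp [completeQuot]
    | succ i ih =>
      intro hle
      have e0 := (ih (by omega)).1
      have e1 : a (i + 1) = b (i + 1) := by
        refine hab _ (by omega) hle ?_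
        have h2 : a (i + 1) - b (i + 1) =
            (completeQuot b α (i + 1))⁻¹ - (completeQuot a α (i + 1))⁻¹ := by
          rw [completeQuot_eq_add_inv a α i, completeQuot_eq_add_inv b α i] at e0
          linear_combination e0
        rw [h2]
        exact (v.map_sub _ _).trans_lt (max_lt (valuation_inv_lt_one v hτ (hi _ hle))
          (valuation_inv_lt_one v hτ (ha _ hle)))
      refine ⟨?_, fun _ => e1⟩
      rw [completeQuot, completeQuot, e0, e1]
  refine ⟨fun j h1 h2 => (key j h2).2 h1, ?_⟩
  rw [(key _ le_rfl).1, e]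

lemma valuation_cden {τ : Γ₀} (hτ : 1 < τ) (a : ℕ → K) (ha : ∀ j, 1 ≤ j → τ ≤ v (a j)) (n : ℕ) :
    τ ^ n ≤ v (cden a (n + 1)) ∧ v (cden a n) < v (cden a (n + 1)) := by
  induction n with
  | zero => simp [cden]
  | succ n ih =>
    have h1 : v (cden a (n + 2)) = v (a (n + 2)) * v (cden a (n + 1)) := by
      rw [cden, ← map_mul]
      apply Valuation.map_add_eq_of_lt_left
      rw [map_mul]
      refine ih.2.trans_le (le_mul_of_one_le_left' ?_)
      exact hτ.le.trans (ha _ (by omega))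
    have h2 := ha (n + 2) (by omega)
    have h3 : 0 < v (cden a (n + 1)) := zero_le.trans_lt ih.2
    rw [h1]
    constructor
    · rw [pow_succ']
      exact mul_le_mul' h2 ih.1
    · exact lt_mul_of_one_lt_left h3 (hτ.trans_le h2)

end ContinuedFraction

/-! ### Convergence in the field of Laurent series -/

section Convergence

open Filter Topology WithZero

variable {F : Type*} [Field F]

lemma LaurentSeries.tendsto_iff (u : ℕ → LaurentSeries F) (α : LaurentSeries F) :
    Tendsto u atTop (𝓝 α) ↔
      ∀ γ : ℤᵐ⁰, γ ≠ 0 → ∀ᶠ n in atTop, Valued.v (u n - α) < γ := by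
  constructor
  · intro h γ hγ
    obtain ⟨x, rfl⟩ := LaurentSeries.valuation_surjective F γ
    have hx : (Valued.v (R := LaurentSeries F)).restrict x ≠ 0 := by simpa using hγ
    refine h.eventually (p := fun y => Valued.v (y - α) < Valued.v x)
      (Valued.mem_nhds.2 ⟨Units.mk0 _ hx, fun y hy => ?_⟩)
    exact (Valued.v (R := LaurentSeries F)).restrict_lt_iff.1 hy
  · intro h s hs
    obtain ⟨γ, hγ⟩ := Valued.mem_nhds.1 hs
    have h1 := h (MonoidWithZeroHom.ValueGroup₀.embedding γ.1) (by simp)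
    refine Filter.mem_map.2 (h1.mono fun n hn => ?_)
    refine hγ ?_
    exact ((Valued.v (R := LaurentSeries F)).restrict_lt_iff_lt_embedding).2 hn

lemma convergesTo_of_completeQuot {τ : ℤᵐ⁰} (hτ : 1 < τ) (a : ℕ → LaurentSeries F)
    (α : LaurentSeries F) (ha : ∀ j, 1 ≤ j → τ ≤ Valued.v (a j))
    (hc : ∀ i, τ ≤ Valued.v (completeQuot a α i)) : ConvergesTo F a α := by
  refine (LaurentSeries.tendsto_iff _ _).2 fun γ hγ => ?_
  have key : ∀ n, Valued.v (cnum a (n + 1) / cden a (n + 1) - α) ≤ (τ ^ n)⁻¹ := by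
    intro n
    obtain ⟨h1, h2⟩ := valuation_cden Valued.v hτ a ha n
    have hc1 := hc (n + 1)
    have h3 := mobius_completeQuot a α n fun i _ _ => ne_zero_of_le_valuation Valued.v hτ (hc i)
    have h4 := cnum_mul_cden_sub a n
    set y := completeQuot a α (n + 1)
    set D := cden a (n + 1)
    set N := cnum a (n + 1)
    have hτn : 1 ≤ τ ^ n := one_le_pow₀ hτ.le
    have hDpos : 0 < Valued.v D := zero_lt_one.trans_le (hτn.trans h1)
    have hD : D ≠ 0 := (Valuation.ne_zero_iff _).1 hDpos.ne'
    have h5 : Valued.v (D * y + cden a n) = Valued.v D * Valued.v y := by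
      rw [← map_mul]
      apply Valuation.map_add_eq_of_lt_left
      rw [map_mul]
      exact h2.trans_le (le_mul_of_one_le_right' (hτ.le.trans hc1))
    have h6 : (N / D - α) * (D * (D * y + cden a n)) = (-1) ^ (n + 1) := by
      rw [← h4]
      field_simp
      linear_combination (-D) * h3
    have h7 := congrArg Valued.v h6
    rw [map_mul, map_mul, h5, map_pow, Valuation.map_neg, map_one, one_pow] at h7
    rw [eq_inv_of_mul_eq_one_left h7]
    refine inv_anti₀ (zero_lt_one.trans_le hτn) ?_
    refine (h1.trans ?_)
    refine le_mul_of_one_le_right' ?_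
    exact one_le_mul (hτn.trans h1) (hτ.le.trans hc1)
  obtain ⟨m, hm⟩ := MulArchimedean.arch γ⁻¹ hτ
  filter_upwards [eventually_ge_atTop (m + 2)] with n hn
  obtain ⟨n, rfl⟩ : ∃ j, n = j + 1 := ⟨n - 1, by omega⟩
  refine (key n).trans_lt ?_
  refine (inv_lt_comm₀ (pow_pos (zero_lt_one.trans hτ) n) (zero_lt_iff.2 hγ)).2 ?_
  exact hm.trans_lt (pow_lt_pow_right₀ hτ (by omega))

/-- The complete quotients of a convergent infinite continued fraction. -/
lemma completeQuot_of_convergesTo {τ : ℤᵐ⁰} (hτ : 1 < τ) (a : ℕ → LaurentSeries F)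
    (α : LaurentSeries F) (ha : ∀ j, 1 ≤ j → τ ≤ Valued.v (a j))
    (h : ConvergesTo F a α) (n : ℕ) :
    Valued.v (completeQuot a α n) = Valued.v (a (n + 1)) := by
  set w : ℕ → LaurentSeries F := fun N => cnum a N / cden a N with hw
  have hm : ∀ N, w (N + 2) * (cden a (N + 1) * a (N + 2) + cden a N) =
      cnum a (N + 1) * a (N + 2) + cnum a N := by
    intro N
    have hD : cden a (N + 2) ≠ 0 := by
      refine (Valuation.ne_zero_iff Valued.v).1 ?_
      exact (zero_le.trans_lt (valuation_cden Valued.v hτ a ha (N + 1)).2).ne'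
    have e1 : cden a (N + 2) = cden a (N + 1) * a (N + 2) + cden a N := by
      rw [cden, mul_comm]
    have e2 : cnum a (N + 2) = cnum a (N + 1) * a (N + 2) + cnum a N := by
      rw [cnum, mul_comm]
    rw [← e1, ← e2]
    exact div_mul_cancel₀ _ hD
  have hq : ∀ N, ∀ i ≤ N + 1, τ ≤ Valued.v (completeQuot a (w (N + 2)) i) := fun N =>
    (completeQuot_of_mobius Valued.v hτ a (w (N + 2)) N (a (N + 2)) (fun j h1 _ => ha j h1)
      (ha _ (by omega)) (hm N)).2
  have hval : ∀ N n, n ≤ N → Valued.v (completeQuot a (w (N + 2)) n) = Valued.v (a (n + 1)) := by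
    intro N n hn
    rw [completeQuot_eq_add_inv, valuation_add_inv Valued.v hτ (ha _ (by omega))
      (hq N (n + 1) (by omega))]
  have hconv : ∀ n, Tendsto (fun N => completeQuot a (w (N + 2)) n) atTop
      (𝓝 (completeQuot a α n)) ∧ Valued.v (completeQuot a α n) = Valued.v (a (n + 1)) := by
    have step : ∀ n, Tendsto (fun N => completeQuot a (w (N + 2)) n) atTop
        (𝓝 (completeQuot a α n)) → Valued.v (completeQuot a α n) = Valued.v (a (n + 1)) := by
      intro n hn
      have h1 := (LaurentSeries.tendsto_iff _ _).1 hn 1 one_ne_zero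
      obtain ⟨N, hN1, hN2⟩ := (h1.and (eventually_ge_atTop n)).exists
      rw [← hval N n hN2]
      symm
      rw [← Valuation.map_sub_swap] at hN1
      have h2 : Valued.v (completeQuot a α n - completeQuot a (w (N + 2)) n) <
          Valued.v (completeQuot a (w (N + 2)) n) :=
        hN1.trans (hτ.trans_le (hq N n (by omega)))
      have h3 := Valuation.map_add_eq_of_lt_right _ h2
      rw [sub_add_cancel] at h3
      exact h3.symm
    intro n
    induction n with
    | zero =>
      have h0 : Tendsto (fun N => completeQuot a (w (N + 2)) 0) atTop (𝓝 (completeQuot a α 0)) :=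
        h.comp (tendsto_add_atTop_nat 2)
      exact ⟨h0, step 0 h0⟩
    | succ n ih =>
      have hne : completeQuot a α n - a (n + 1) ≠ 0 := by
        intro hz
        have h1 := (LaurentSeries.tendsto_iff _ _).1 ih.1 (Valued.v (a (n + 2)))⁻¹ (by
          refine inv_ne_zero ?_
          exact ((zero_lt_one.trans hτ).trans_le (ha _ (by omega))).ne')
        obtain ⟨N, hN1, hN2⟩ := (h1.and (eventually_ge_atTop (n + 1))).exists
        rw [sub_eq_zero] at hz
        rw [hz] at hN1
        have h2 := hval N (n + 1) hN2
        rw [completeQuot, map_inv₀] at h2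
        rw [← inv_inv (Valued.v (_ - _)), h2] at hN1
        exact lt_irrefl _ hN1
      have h1 : Tendsto (fun N => completeQuot a (w (N + 2)) (n + 1)) atTop
          (𝓝 (completeQuot a α (n + 1))) := (ih.1.sub_const _).inv₀ hne
      exact ⟨h1, step _ h1⟩
  exact (hconv n).2

end Convergence

/-! ### Continuants over a commutative ring -/

section Continuant

variable {R : Type*} [CommRing R]

/-- Continuant numerators over a commutative ring. -/
def contNum (a : ℕ → R) : ℕ → R
  | 0 => 1
  | 1 => a 1
  | n + 2 => a (n + 2) * contNum a (n + 1) + contNum a n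

/-- Continuant denominators over a commutative ring. -/
def contDen (a : ℕ → R) : ℕ → R
  | 0 => 0
  | 1 => 1
  | n + 2 => a (n + 2) * contDen a (n + 1) + contDen a n

lemma map_contNum {S : Type*} [CommRing S] (φ : R →+* S) (a : ℕ → R) (n : ℕ) :
    φ (contNum a n) = contNum (fun j => φ (a j)) n := by
  induction n using Nat.twoStepInduction with
  | zero => simp [contNum]
  | one => rfl
  | more n ih1 ih2 => simp [contNum, ih1, ih2]

lemma map_contDen {S : Type*} [CommRing S] (φ : R →+* S) (a : ℕ → R) (n : ℕ) :
    φ (contDen a n) = contDen (fun j => φ (a j)) n := by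
  induction n using Nat.twoStepInduction with
  | zero => simp [contDen]
  | one => simp [contDen]
  | more n ih1 ih2 => simp [contDen, ih1, ih2]

lemma contNum_congr {a b : ℕ → R} {n : ℕ} (h : ∀ j, 1 ≤ j → j ≤ n → a j = b j) :
    contNum a n = contNum b n := by
  induction n using Nat.twoStepInduction with
  | zero => rfl
  | one => exact h 1 le_rfl le_rfl
  | more n ih1 ih2 =>
    rw [contNum, contNum, ih1 fun j h1 h2 => h j h1 (by omega),
      ih2 fun j h1 h2 => h j h1 (by omega), h (n + 2) (by omega) le_rfl]

lemma contDen_congr {a b : ℕ → R} {n : ℕ} (h : ∀ j, 1 ≤ j → j ≤ n → a j = b j) :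
    contDen a n = contDen b n := by
  induction n using Nat.twoStepInduction with
  | zero => rfl
  | one => rfl
  | more n ih1 ih2 =>
    rw [contDen, contDen, ih1 fun j h1 h2 => h j h1 (by omega),
      ih2 fun j h1 h2 => h j h1 (by omega), h (n + 2) (by omega) le_rfl]

lemma contNum_mul_contDen_sub (a : ℕ → R) (n : ℕ) :
    contNum a (n + 1) * contDen a n - contNum a n * contDen a (n + 1) = (-1) ^ (n + 1) := by
  induction n with
  | zero => simp [contNum, contDen]
  | succ n ih =>
    rw [contNum, contDen, pow_succ, ← ih]
    ring

lemma cnum_eq_contNum {K : Type*} [Field K] (a : ℕ → K) (n : ℕ) : cnum a n = contNum a n := by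
  induction n using Nat.twoStepInduction with
  | zero => rfl
  | one => rfl
  | more n ih1 ih2 => rw [cnum, contNum, ih1, ih2]

lemma cden_eq_contDen {K : Type*} [Field K] (a : ℕ → K) (n : ℕ) : cden a n = contDen a n := by
  induction n using Nat.twoStepInduction with
  | zero => rfl
  | one => rfl
  | more n ih1 ih2 => rw [cden, contDen, ih1, ih2]

end Continuant

/-! ### The continued fraction of `P_k / Q_k` over the rationals -/

section Rational

/-- The coefficients of the three-term recurrence of the monic Gegenbauer polynomials
with parameter `1/2 - k`. -/
def gegenbauerCoeff (k n : ℕ) : ℚ :=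
  n * (2 * k - n) / ((2 * k - 2 * n - 1) * (2 * k - 2 * n + 1))

/-- The monic Gegenbauer polynomials with parameter `1/2 - k`. -/
def monicGegenbauer (k : ℕ) : ℕ → ℚ[X]
  | 0 => 1
  | 1 => X
  | n + 2 => X * monicGegenbauer k (n + 1) +
      C (gegenbauerCoeff k (n + 1)) * monicGegenbauer k n

/-- The polynomial `Q_k` over `ℚ`. -/
def QkRat (k : ℕ) : ℚ[X] := ∑ i ∈ Finset.range k, C (bRat k i) * X ^ (2 * i + 1)

lemma C_two_rat : (C (2 : ℚ)) = 2 := rfl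

lemma two_mul_sub_odd_ne_zero (k n : ℕ) : (2 * k - 2 * n - 1 : ℚ) ≠ 0 := by
  intro h
  have : (2 * k - 2 * n - 1 : ℤ) = 0 := by exact_mod_cast h
  omega

lemma monicGegenbauer_derivative (k n : ℕ) :
    (X ^ 2 - 1) * derivative (monicGegenbauer k (n + 1)) =
        C (n + 1 : ℚ) * X * monicGegenbauer k (n + 1) +
          C (-((n + 1) * (2 * k - n - 1) / (2 * k - 2 * n - 1)) : ℚ) * monicGegenbauer k n ∧
      (X ^ 2 - 1) * derivative (monicGegenbauer k n) =
        C (2 * k - n - 1 : ℚ) * X * monicGegenbauer k n +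
          C (2 * n + 1 - 2 * k : ℚ) * monicGegenbauer k (n + 1) := by
  induction n with
  | zero =>
    have h := two_mul_sub_odd_ne_zero k 0
    have e : (-((0 + 1) * (2 * k - 0 - 1) / (2 * k - 2 * 0 - 1)) : ℚ) = -1 := by
      simp only [Nat.cast_zero] at h
      rw [zero_add, one_mul, sub_zero, mul_zero, sub_zero]
      rw [mul_zero, sub_zero] at h
      rw [div_self h]
    simp only [Nat.cast_zero, e, monicGegenbauer]
    constructor
    · simp
      ring
    · simp
      ring
  | succ n ih =>
    obtain ⟨h1, h2⟩ := ih
    have hd := two_mul_sub_odd_ne_zero k n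
    have hd1 := two_mul_sub_odd_ne_zero k (n + 1)
    have hc : C (gegenbauerCoeff k (n + 1)) * C (2 * (n + 1 : ℚ) + 1 - 2 * k) =
        C (-((n + 1) * (2 * k - n - 1) / (2 * k - 2 * n - 1)) : ℚ) := by
      rw [← C_mul, gegenbauerCoeff]
      congr 1
      push_cast at hd1 ⊢
      rw [show (2 * k - 2 * (n + 1) + 1 : ℚ) = 2 * k - 2 * n - 1 by ring,
        show (2 * (n + 1) + 1 - 2 * k : ℚ) = -(2 * k - 2 * (n + 1) - 1) by ring]
      generalize (2 * k - 2 * (n + 1) - 1 : ℚ) = A at *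
      generalize (2 * k - 2 * n - 1 : ℚ) = B at *
      field_simp
      ring
    have hc2 : C (gegenbauerCoeff k (n + 1)) * C (2 * n + 1 - 2 * k : ℚ) - 1 =
        C (-((n + 1 + 1) * (2 * k - (n + 1) - 1) / (2 * k - 2 * (n + 1) - 1)) : ℚ) := by
      rw [← C_mul, gegenbauerCoeff, ← C_1, ← C_sub]
      congr 1
      push_cast at hd1 ⊢
      rw [show (2 * k - 2 * (n + 1) + 1 : ℚ) = 2 * k - 2 * n - 1 by ring,
        show (2 * n + 1 - 2 * k : ℚ) = -(2 * k - 2 * n - 1) by ring]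
      generalize hA : (2 * k - 2 * (n + 1) - 1 : ℚ) = A at *
      generalize (2 * k - 2 * n - 1 : ℚ) = B at *
      field_simp
      rw [← hA]
      ring
    have h3 : (X ^ 2 - 1) * derivative (monicGegenbauer k (n + 1)) =
        C (2 * k - (n + 1 : ℕ) - 1 : ℚ) * X * monicGegenbauer k (n + 1) +
          C (2 * (n + 1 : ℕ) + 1 - 2 * k : ℚ) * monicGegenbauer k (n + 1 + 1) := by
      rw [h1, monicGegenbauer, ← hc]
      simp only [C_sub, C_add, C_mul, C_1, Nat.cast_add, Nat.cast_one, C_two_rat]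
      ring
    refine ⟨?_, h3⟩
    push_cast
    rw [← hc2, monicGegenbauer, derivative_add, derivative_mul, derivative_X, derivative_C_mul,
      mul_add, mul_add, mul_left_comm (X ^ 2 - 1) X, mul_left_comm _ (C _), h2, h1, ← hc]
    simp only [C_sub, C_add, C_mul, C_1, C_two_rat]
    ring

lemma monicGegenbauer_natDegree (k n : ℕ) :
    (monicGegenbauer k n).natDegree ≤ n ∧ (monicGegenbauer k n).coeff n = 1 := by
  induction n using Nat.twoStepInduction with
  | zero => simp [monicGegenbauer]
  | one => simp [monicGegenbauer]
  | more n ih1 ih2 =>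
    rw [monicGegenbauer]
    constructor
    · refine (natDegree_add_le _ _).trans (max_le ?_ ?_)
      · refine natDegree_mul_le.trans ?_
        rw [natDegree_X]
        omega
      · refine (natDegree_C_mul_le _ _).trans ?_
        omega
    · rw [coeff_add, coeff_X_mul, ih2.2, coeff_C_mul, coeff_eq_zero_of_natDegree_lt]
      · simp
      · omega

lemma eq_zero_of_derivative_eq {D : ℚ[X]} {m : ℕ} (hm : 1 ≤ m) (hdeg : D.natDegree ≤ m)
    (hm0 : D.coeff m = 0) (h : (X ^ 2 - 1) * derivative D = C (m : ℚ) * X * D) : D = 0 := by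
  by_contra hD
  have hlt : D.natDegree < m := by
    refine lt_of_le_of_ne hdeg fun h1 => hD ?_
    rw [← leadingCoeff_eq_zero, leadingCoeff, h1, hm0]
  have h2 := congrArg (fun q => coeff q (D.natDegree + 1)) h
  rw [mul_assoc, coeff_C_mul, coeff_X_mul, sub_mul, one_mul, coeff_sub,
    coeff_derivative, coeff_eq_zero_of_natDegree_lt (p := D) (by omega), pow_two, mul_assoc,
    coeff_X_mul, zero_mul, sub_zero] at h2
  have hl : D.coeff D.natDegree ≠ 0 := by simpa using hD
  rcases hd : D.natDegree with _ | d
  · rw [hd] at h2 hl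
    rw [mul_coeff_zero, coeff_X_zero, zero_mul] at h2
    have : (m : ℚ) = 0 := by simpa [hl] using h2.symm
    have : m = 0 := by exact_mod_cast this
    omega
  · rw [hd] at h2 hl
    rw [coeff_X_mul, coeff_derivative] at h2
    have h3 : ((d : ℚ) + 1 - m) * D.coeff (d + 1) = 0 := by linear_combination h2
    rcases mul_eq_zero.1 h3 with h4 | h4
    · have : d + 1 = m := by
        have : (d : ℚ) + 1 = m := by linarith
        exact_mod_cast this
      omega
    · exact hl h4

lemma monicGegenbauer_two_mul {k : ℕ} (hk : 1 ≤ k) :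
    monicGegenbauer k (2 * k) = (X ^ 2 - 1) ^ k := by
  have hmon : ((X ^ 2 - 1 : ℚ[X]) ^ k).Monic := (monic_X_pow_sub_C (1 : ℚ) two_ne_zero).pow k
  have hdeg : ((X ^ 2 - 1 : ℚ[X]) ^ k).natDegree = 2 * k := by
    rw [natDegree_pow, ← C_1, natDegree_X_pow_sub_C, mul_comm]
  obtain ⟨h1, h2⟩ := monicGegenbauer_natDegree k (2 * k)
  refine sub_eq_zero.1 (eq_zero_of_derivative_eq (m := 2 * k) (by omega) ?_ ?_ ?_)
  · exact (natDegree_sub_le _ _).trans (max_le h1 hdeg.le)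
  · rw [coeff_sub, h2]
    have := hmon.coeff_natDegree
    rw [hdeg] at this
    rw [this, sub_self]
  · have h3 := (monicGegenbauer_derivative k (2 * k - 1)).1
    rw [show 2 * k - 1 + 1 = 2 * k by omega] at h3
    have e1 : ((2 * k - 1 : ℕ) : ℚ) = 2 * k - 1 := by
      rw [Nat.cast_sub (by omega)]
      push_cast
      ring
    rw [e1] at h3
    have e2 : (-((2 * k - 1 + 1) * (2 * k - (2 * k - 1) - 1) / (2 * k - 2 * (2 * k - 1) - 1)) : ℚ)
        = 0 := by
      rw [show (2 * k - (2 * k - 1) - 1 : ℚ) = 0 by ring]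
      simp
    rw [e2] at h3
    rw [derivative_sub, mul_sub, h3, derivative_pow]
    obtain ⟨k, rfl⟩ : ∃ j, k = j + 1 := ⟨k - 1, by omega⟩
    simp only [derivative_sub, derivative_X_pow, derivative_one, Nat.add_sub_cancel]
    simp only [C_sub, C_add, C_mul, C_1, C_0, Nat.cast_mul, Nat.cast_add, Nat.cast_one,
      Nat.cast_ofNat, pow_succ, C_two_rat]
    ring

lemma derivative_QkRat {k : ℕ} (hk : 1 ≤ k) : derivative (QkRat k) = (X ^ 2 - 1) ^ (k - 1) := by
  rw [sub_pow, QkRat, derivative_sum]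
  rw [show k - 1 + 1 = k by omega]
  refine Finset.sum_congr rfl fun i hi => ?_
  have hi' : i < k := Finset.mem_range.1 hi
  rw [derivative_C_mul_X_pow, bRat]
  have h : (2 * (i : ℚ) + 1) ≠ 0 := by positivity
  have e : ((-1 : ℚ[X])) ^ (i + (k - 1)) = C ((-1) ^ (k - 1 - i)) := by
    rw [show i + (k - 1) = 2 * i + (k - 1 - i) by omega, pow_add, pow_mul]
    simp
  have e2 : (-1) ^ (k - 1 - i) * ((k - 1).choose i : ℚ) * (2 * (i : ℚ) + 1)⁻¹ * (2 * i + 1 : ℕ) =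
      (-1) ^ (k - 1 - i) * ((k - 1).choose i : ℚ) := by
    push_cast
    field_simp
  rw [e, e2, one_pow, mul_one, Nat.add_sub_cancel, ← pow_mul, C_mul, C_eq_natCast]
  ring

lemma monicGegenbauer_eval_zero (k n : ℕ) : (monicGegenbauer k (2 * n + 1)).eval 0 = 0 := by
  induction n with
  | zero => simp [monicGegenbauer]
  | succ n ih =>
    rw [show 2 * (n + 1) + 1 = 2 * n + 1 + 2 by ring, monicGegenbauer]
    simp [ih]

lemma monicGegenbauer_two_mul_sub_one {k : ℕ} (hk : 1 ≤ k) :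
    monicGegenbauer k (2 * k - 1) = C (2 * k - 1 : ℚ) * QkRat k := by
  have hd : derivative (monicGegenbauer k (2 * k - 1) - C (2 * k - 1 : ℚ) * QkRat k) = 0 := by
    have hne : (X ^ 2 - 1 : ℚ[X]) ≠ 0 := (monic_X_pow_sub_C (1 : ℚ) two_ne_zero).ne_zero
    refine mul_left_cancel₀ hne ?_
    have h3 := (monicGegenbauer_derivative k (2 * k - 1)).2
    rw [show 2 * k - 1 + 1 = 2 * k by omega] at h3
    have e1 : ((2 * k - 1 : ℕ) : ℚ) = 2 * k - 1 := by
      rw [Nat.cast_sub (by omega)]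
      push_cast
      ring
    rw [e1, monicGegenbauer_two_mul hk] at h3
    rw [derivative_sub, mul_sub, h3, derivative_C_mul, derivative_QkRat hk]
    obtain ⟨k, rfl⟩ : ∃ j, k = j + 1 := ⟨k - 1, by omega⟩
    simp only [C_sub, C_add, C_mul, C_1, Nat.cast_add, Nat.cast_one, Nat.add_sub_cancel, pow_succ,
      C_two_rat]
    ring
  have h0 := derivative_eq_zero.1 hd
  have h1 := eq_C_of_natDegree_eq_zero h0
  rw [coeff_zero_eq_eval_zero, eval_sub, eval_mul, QkRat, eval_finsetSum] at h1
  obtain ⟨m, hm⟩ : ∃ m, 2 * k - 1 = 2 * m + 1 := ⟨k - 1, by omega⟩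
  rw [hm, monicGegenbauer_eval_zero] at h1
  rw [hm]
  refine sub_eq_zero.1 (h1.trans ?_)
  simp

end Rational

section ContinuantSymmetry

variable {R : Type*} [CommRing R]

lemma contNum_succ_succ_left (a : ℕ → R) (n : ℕ) :
    contNum a (n + 2) =
      a 1 * contNum (fun j => a (j + 1)) (n + 1) + contNum (fun j => a (j + 2)) n := by
  induction n using Nat.twoStepInduction with
  | zero =>
    simp [contNum]
    ring
  | one =>
    simp [contNum]
    ring
  | more n ih1 ih2 =>
    rw [contNum, ih1, ih2]
    simp only [contNum]
    ring

lemma contDen_succ (a : ℕ → R) (n : ℕ) :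
    contDen a (n + 1) = contNum (fun j => a (j + 1)) n := by
  induction n using Nat.twoStepInduction with
  | zero => rfl
  | one => simp [contDen, contNum]
  | more n ih1 ih2 => rw [contDen, ih1, ih2, contNum]

lemma contNum_reverse (a : ℕ → R) (n : ℕ) : contNum (fun j => a (n + 1 - j)) n = contNum a n := by
  induction n using Nat.twoStepInduction with
  | zero => rfl
  | one => rfl
  | more n ih1 ih2 =>
    rw [contNum_succ_succ_left, contNum, ← ih1, ← ih2]
    have e1 : contNum (fun j => a (n + 2 + 1 - (j + 1))) (n + 1) =
        contNum (fun j => a (n + 1 + 1 - j)) (n + 1) :=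
      contNum_congr fun j _ _ => congrArg a (by omega)
    have e2 : contNum (fun j => a (n + 2 + 1 - (j + 2))) n =
        contNum (fun j => a (n + 1 - j)) n :=
      contNum_congr fun j _ _ => congrArg a (by omega)
    rw [e1, e2]
    rfl

/-- Continuants of a sequence rescaled alternately by `s` and `s⁻¹`. -/
lemma contNum_scale {s u : R} (hsu : s * u = 1) {a b : ℕ → R} {n : ℕ}
    (ho : ∀ j, 2 * j + 1 ≤ n → b (2 * j + 1) = s * a (2 * j + 1))
    (he : ∀ j, 2 * j + 2 ≤ n → b (2 * j + 2) = u * a (2 * j + 2)) :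
    (∀ j, 2 * j ≤ n → contNum b (2 * j) = contNum a (2 * j)) ∧
      ∀ j, 2 * j + 1 ≤ n → contNum b (2 * j + 1) = s * contNum a (2 * j + 1) := by
  have key : ∀ j, (2 * j ≤ n → contNum b (2 * j) = contNum a (2 * j)) ∧
      (2 * j + 1 ≤ n → contNum b (2 * j + 1) = s * contNum a (2 * j + 1)) := by
    intro j
    induction j with
    | zero => exact ⟨fun _ => rfl, fun h => ho 0 h⟩
    | succ j ih =>
      have h1 : 2 * (j + 1) ≤ n → contNum b (2 * (j + 1)) = contNum a (2 * (j + 1)) := by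
        intro h
        rw [show 2 * (j + 1) = 2 * j + 2 by ring, contNum, contNum, he j h,
          ih.1 (by omega), ih.2 (by omega)]
        linear_combination (a (2 * j + 2) * contNum a (2 * j + 1)) * hsu
      refine ⟨h1, fun h => ?_⟩
      have h2 := h1 (by omega)
      rw [show 2 * (j + 1) = 2 * j + 2 by ring] at h2
      have h3 := ho (j + 1) h
      rw [show 2 * (j + 1) + 1 = 2 * j + 1 + 2 by ring] at h3 ⊢
      have e : ∀ c : ℕ → R, contNum c (2 * j + 1 + 2) =
          c (2 * j + 1 + 2) * contNum c (2 * j + 2) + contNum c (2 * j + 1) := fun _ => rfl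
      rw [e, e, h3, h2, ih.2 (by omega)]
      ring
  exact ⟨fun j => (key j).1, fun j => (key j).2⟩

lemma contDen_scale {s u : R} (hsu : s * u = 1) {a b : ℕ → R} {n : ℕ}
    (ho : ∀ j, 2 * j + 1 ≤ n → b (2 * j + 1) = s * a (2 * j + 1))
    (he : ∀ j, 2 * j + 2 ≤ n → b (2 * j + 2) = u * a (2 * j + 2)) :
    (∀ j, 2 * j ≤ n → contDen b (2 * j) = u * contDen a (2 * j)) ∧
      ∀ j, 2 * j + 1 ≤ n → contDen b (2 * j + 1) = contDen a (2 * j + 1) := by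
  have key : ∀ j, (2 * j ≤ n → contDen b (2 * j) = u * contDen a (2 * j)) ∧
      (2 * j + 1 ≤ n → contDen b (2 * j + 1) = contDen a (2 * j + 1)) := by
    intro j
    induction j with
    | zero => exact ⟨fun _ => (mul_zero u).symm, fun _ => rfl⟩
    | succ j ih =>
      have h1 : 2 * (j + 1) ≤ n → contDen b (2 * (j + 1)) = u * contDen a (2 * (j + 1)) := by
        intro h
        rw [show 2 * (j + 1) = 2 * j + 2 by ring, contDen, contDen, he j h,
          ih.1 (by omega), ih.2 (by omega)]
        ring
      refine ⟨h1, fun h => ?_⟩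
      have h2 := h1 (by omega)
      rw [show 2 * (j + 1) = 2 * j + 2 by ring] at h2
      have h3 := ho (j + 1) h
      rw [show 2 * (j + 1) + 1 = 2 * j + 1 + 2 by ring] at h3 ⊢
      have e : ∀ c : ℕ → R, contDen c (2 * j + 1 + 2) =
          c (2 * j + 1 + 2) * contDen c (2 * j + 2) + contDen c (2 * j + 1) := fun _ => rfl
      rw [e, e, h3, h2, ih.2 (by omega)]
      linear_combination (a (2 * j + 1 + 2) * contDen a (2 * j + 2)) * hsu
  exact ⟨fun j => (key j).1, fun j => (key j).2⟩

end ContinuantSymmetry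

section Rational

lemma vRat_ne_zero {k j : ℕ} (hj : 1 ≤ j) (hjk : j ≤ 2 * k) : vRat k j ≠ 0 := by
  induction j with
  | zero => omega
  | succ j ih =>
    rcases j with _ | j
    · have := two_mul_sub_odd_ne_zero k 0
      simpa [vRat] using this
    · rw [vRat]
      have h1 := two_mul_sub_odd_ne_zero k (j + 1)
      have h2 := two_mul_sub_odd_ne_zero k j
      have h3 : ((j : ℚ) + 1) ≠ 0 := by positivity
      have h4 : (2 * (k : ℚ) - ((j : ℚ) + 1)) ≠ 0 := by
        have : ((j + 2 : ℕ) : ℚ) ≤ (2 * k : ℕ) := by exact_mod_cast hjk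
        push_cast at this
        linarith
      have h5 : (2 * (k : ℚ) - 2 * ((j : ℚ) + 1) + 1) ≠ 0 := by
        convert h2 using 1
        ring
      push_cast at h1
      exact div_ne_zero (div_ne_zero (mul_ne_zero h1 h5) (mul_ne_zero h3 h4))
        (ih (by omega) (by omega))

lemma vRat_mul {k j : ℕ} (hj : j + 2 ≤ 2 * k) :
    vRat k (j + 2) * vRat k (j + 1) = (gegenbauerCoeff k (j + 1))⁻¹ := by
  rw [vRat, div_mul_cancel₀ _ (vRat_ne_zero (by omega) (by omega)), gegenbauerCoeff, inv_div]
  push_cast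
  rfl

lemma gegenbauerCoeff_ne_zero {k j : ℕ} (hj : j + 2 ≤ 2 * k) :
    gegenbauerCoeff k (j + 1) ≠ 0 := by
  rw [← inv_inv (gegenbauerCoeff k (j + 1)), ← vRat_mul hj]
  exact inv_ne_zero <| mul_ne_zero (vRat_ne_zero (by omega) (by omega)) (vRat_ne_zero (by omega) (by omega))

lemma gegenbauerCoeff_symm {k i j : ℕ} (h : i + j = 2 * k) :
    gegenbauerCoeff k i = gegenbauerCoeff k j := by
  have : (j : ℚ) = 2 * k - i := by
    have : (i + j : ℚ) = 2 * k := by exact_mod_cast h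
    linarith
  rw [gegenbauerCoeff, gegenbauerCoeff, this]
  congr 1 <;> ring

lemma contNum_vRat {k n : ℕ} (hn : n ≤ 2 * k) :
    contNum (fun j => C (vRat k j) * X) n =
      C (∏ j ∈ Finset.range n, vRat k (j + 1)) * monicGegenbauer k n := by
  induction n using Nat.twoStepInduction with
  | zero => simp [contNum, monicGegenbauer]
  | one => simp [contNum, monicGegenbauer]
  | more n ih1 ih2 =>
    have h1 := vRat_mul hn
    have h2 := gegenbauerCoeff_ne_zero hn
    have h3 : (vRat k (n + 2) * vRat k (n + 1)) * gegenbauerCoeff k (n + 1) = 1 := by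
      rw [h1, inv_mul_cancel₀ h2]
    have h4 := congrArg C h3
    simp only [C_mul, C_1] at h4
    rw [contNum, ih1 (by omega), ih2 (by omega), monicGegenbauer]
    simp only [C_mul, Finset.prod_range_succ]
    linear_combination (-C (∏ j ∈ Finset.range n, vRat k (j + 1)) * monicGegenbauer k n) * h4

lemma contNum_eval_zero {n : ℕ} (c : ℕ → ℚ) :
    (contNum (fun j => C (c j) * X) (2 * n)).eval 0 = 1 := by
  induction n with
  | zero => simp [contNum]
  | succ n ih =>
    rw [show 2 * (n + 1) = 2 * n + 2 by ring, contNum]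
    simp [ih]

lemma prod_vRat {k : ℕ} (hk : 1 ≤ k) : ∏ j ∈ Finset.range (2 * k), vRat k (j + 1) = (-1) ^ k := by
  have h := contNum_eval_zero (n := k) (vRat k)
  rw [contNum_vRat le_rfl, monicGegenbauer_two_mul hk] at h
  simp only [eval_mul, eval_C, eval_pow, eval_sub, eval_X, eval_one] at h
  norm_num at h
  have h2 : ((-1 : ℚ) ^ k) * (-1) ^ k = 1 := by
    rw [← mul_pow]
    norm_num
  exact mul_right_cancel₀ (right_ne_zero_of_mul (h2.trans_ne one_ne_zero)) (h.trans h2.symm)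

lemma contNum_vRat_two_mul {k : ℕ} (hk : 1 ≤ k) :
    contNum (fun j => C (vRat k j) * X) (2 * k) = C ((-1) ^ k) * (X ^ 2 - 1) ^ k := by
  rw [contNum_vRat le_rfl, prod_vRat hk, monicGegenbauer_two_mul hk]

lemma prod_vRat_mul {k : ℕ} (hk : 1 ≤ k) :
    (∏ j ∈ Finset.range (2 * k - 1), vRat k (j + 1)) * vRat k (2 * k) = (-1) ^ k := by
  rw [← prod_vRat hk]
  obtain ⟨m, hm⟩ : ∃ m, 2 * k = m + 1 := ⟨2 * k - 1, by omega⟩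
  rw [hm, Nat.add_sub_cancel, Finset.prod_range_succ]

lemma contNum_vRat_two_mul_sub_one {k : ℕ} (hk : 1 ≤ k) :
    contNum (fun j => C (vRat k j) * X) (2 * k - 1) =
      C ((-1) ^ k * vRat k 1 / vRat k (2 * k)) * QkRat k := by
  rw [contNum_vRat (by omega), monicGegenbauer_two_mul_sub_one hk, ← mul_assoc, ← C_mul]
  congr 2
  rw [eq_div_iff (vRat_ne_zero (by omega) le_rfl), ← prod_vRat_mul hk, vRat]
  ring

/-- The sequence `v` is symmetric up to alternate scaling. -/
lemma vRat_symm {k j : ℕ} :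
    (2 * j + 1 ≤ 2 * k → vRat k (2 * k + 1 - (2 * j + 1)) =
      (vRat k (2 * k) / vRat k 1) * vRat k (2 * j + 1)) ∧
    (2 * j + 2 ≤ 2 * k → vRat k (2 * k + 1 - (2 * j + 2)) =
      (vRat k 1 / vRat k (2 * k)) * vRat k (2 * j + 2)) := by
  have key : ∀ i, i + 2 ≤ 2 * k → vRat k (2 * k + 1 - (i + 2)) * vRat k (2 * k + 1 - (i + 1)) =
      vRat k (i + 2) * vRat k (i + 1) := by
    intro i hi
    obtain ⟨m, hm⟩ : ∃ m, 2 * k = i + 2 + m := ⟨2 * k - (i + 2), by omega⟩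
    have := vRat_mul (k := k) (j := m) (by omega)
    rw [show 2 * k + 1 - (i + 2) = m + 1 by omega, show 2 * k + 1 - (i + 1) = m + 2 by omega,
      mul_comm, this, vRat_mul hi, gegenbauerCoeff_symm (i := m + 1) (j := i + 1) (by omega)]
  have step : ∀ j, (2 * j + 1 ≤ 2 * k → vRat k (2 * k + 1 - (2 * j + 1)) =
      (vRat k (2 * k) / vRat k 1) * vRat k (2 * j + 1)) →
      (2 * j + 2 ≤ 2 * k → vRat k (2 * k + 1 - (2 * j + 2)) =
      (vRat k 1 / vRat k (2 * k)) * vRat k (2 * j + 2)) := by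
    intro j h1 h
    have h2 := key (2 * j) h
    rw [h1 (by omega)] at h2
    have n1 := vRat_ne_zero (k := k) (j := 1) le_rfl (by omega)
    have n2 := vRat_ne_zero (k := k) (j := 2 * k) (by omega) (by omega)
    have n3 := vRat_ne_zero (k := k) (j := 2 * j + 1) (by omega) (by omega)
    refine mul_right_cancel₀ (mul_ne_zero n2 n3) ?_
    field_simp at h2 ⊢
    linear_combination h2
  suffices h : 2 * j + 1 ≤ 2 * k → vRat k (2 * k + 1 - (2 * j + 1)) =
      (vRat k (2 * k) / vRat k 1) * vRat k (2 * j + 1) from ⟨h, step j h⟩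
  induction j with
  | zero =>
    intro h
    have n1 := vRat_ne_zero (k := k) (j := 1) le_rfl (by omega)
    simp only [mul_zero, zero_add, Nat.add_sub_cancel]
    field_simp
  | succ j ih =>
    intro h
    have h1 := step j ih (by omega)
    have h2 := key (2 * j + 1) h
    rw [show 2 * j + 1 + 1 = 2 * j + 2 by ring, h1, show 2 * j + 1 + 2 = 2 * (j + 1) + 1 by ring]
      at h2
    have n1 := vRat_ne_zero (k := k) (j := 1) le_rfl (by omega)
    have n2 := vRat_ne_zero (k := k) (j := 2 * k) (by omega) (by omega)
    have n3 := vRat_ne_zero (k := k) (j := 2 * j + 2) (by omega) (by omega)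
    refine mul_right_cancel₀ (mul_ne_zero n1 n3) ?_
    field_simp at h2 ⊢
    linear_combination h2

lemma contDen_vRat_two_mul {k : ℕ} (hk : 1 ≤ k) :
    contDen (fun j => C (vRat k j) * X) (2 * k) = C ((-1) ^ k) * QkRat k := by
  obtain ⟨m, hm⟩ : ∃ m, 2 * k = 2 * m + 1 + 1 := ⟨k - 1, by omega⟩
  have n1 := vRat_ne_zero (k := k) (j := 1) le_rfl (by omega)
  have n2 := vRat_ne_zero (k := k) (j := 2 * k) (by omega) (by omega)
  have h1 := contNum_vRat_two_mul_sub_one hk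
  rw [hm] at h1
  rw [hm, contDen_succ, ← contNum_reverse]
  have hs := (contNum_scale (s := C (vRat k (2 * k) / vRat k 1))
    (u := C (vRat k 1 / vRat k (2 * k))) (a := fun j => C (vRat k j) * X)
    (b := fun j => C (vRat k (2 * m + 1 + 1 - j + 1)) * X) (n := 2 * m + 1) (by
      rw [← C_mul, ← C_1]
      congr 1
      field_simp) (fun j hj => by
        rw [← mul_assoc, ← C_mul, ← (vRat_symm (k := k) (j := j)).1 (by omega)]
        congr 3
        omega) (fun j hj => by
        rw [← mul_assoc, ← C_mul, ← (vRat_symm (k := k) (j := j)).2 (by omega)]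
        congr 3
        omega)).2 m le_rfl
  rw [hs, ← Nat.add_sub_cancel (2 * m + 1) 1, h1, ← mul_assoc, ← C_mul, ← hm]
  congr 2
  field_simp

lemma X_mul_sq_sub_one_pow {k : ℕ} (hk : 1 ≤ k) :
    X * (X ^ 2 - 1 : ℚ[X]) ^ k = C (2 * k + 1 : ℚ) * QkRat (k + 1) + C (2 * k : ℚ) * QkRat k := by
  have hd : derivative (X * (X ^ 2 - 1 : ℚ[X]) ^ k -
      (C (2 * k + 1 : ℚ) * QkRat (k + 1) + C (2 * k : ℚ) * QkRat k)) = 0 := by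
    rw [derivative_sub, derivative_add, derivative_C_mul, derivative_C_mul, derivative_QkRat hk,
      derivative_QkRat (by omega), derivative_mul, derivative_pow]
    obtain ⟨k, rfl⟩ : ∃ j, k = j + 1 := ⟨k - 1, by omega⟩
    simp only [derivative_sub, derivative_X_pow, derivative_one, derivative_X, Nat.add_sub_cancel]
    simp only [C_add, C_mul, C_1, Nat.cast_add, Nat.cast_one, Nat.cast_ofNat, pow_succ, C_two_rat]
    ring
  have h1 := eq_C_of_natDegree_eq_zero (derivative_eq_zero.1 hd)
  refine sub_eq_zero.1 (h1.trans ?_)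
  rw [coeff_zero_eq_eval_zero, QkRat, QkRat]
  simp [eval_finsetSum]

lemma two_mul_thetaRat_mul_eval {k : ℕ} (hk : 1 ≤ k) :
    2 * k * thetaRat k * (QkRat k).eval 1 = -1 := by
  induction k, hk using Nat.le_induction with
  | base => norm_num [thetaRat, QkRat, bRat]
  | succ k hk ih =>
    have h1 := congrArg (eval 1) (X_mul_sq_sub_one_pow hk)
    simp only [eval_mul, eval_add, eval_C, eval_X, eval_pow, eval_sub, eval_one] at h1
    rw [one_pow, sub_self, zero_pow (by omega), mul_zero] at h1
    have h2 : ((k : ℚ) + 1) * (Nat.choose (2 * (k + 1)) (k + 1) : ℚ) =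
        2 * (2 * k + 1) * (Nat.choose (2 * k) k : ℚ) := by
      have := Nat.succ_mul_centralBinom_succ k
      rw [Nat.centralBinom, Nat.centralBinom] at this
      exact_mod_cast this
    have h3 : ((2 : ℚ) ^ (2 * (k + 1)))⁻¹ = ((2 : ℚ) ^ (2 * k))⁻¹ * (1 / 4) := by
      rw [show 2 * (k + 1) = 2 * k + 2 by ring, pow_add, mul_inv]
      norm_num
    rw [← ih, thetaRat, thetaRat, h3]
    push_cast
    set B : ℚ := ((2 : ℚ) ^ (2 * k))⁻¹
    set Q1 := eval 1 (QkRat (k + 1))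
    rw [pow_succ]
    linear_combination (-(1 / 2 : ℚ) * (-1) ^ k * B * Q1) * h2 +
      ((-1) ^ k * B * (Nat.choose (2 * k) k : ℚ)) * h1

lemma vRat_one_div {k : ℕ} (hk : 1 ≤ k) :
    vRat k 1 / vRat k (2 * k) = -(2 * k * thetaRat k) ^ 2 := by
  have h := contNum_mul_contDen_sub (fun j => C (vRat k j) * X) (2 * k - 1)
  rw [show 2 * k - 1 + 1 = 2 * k by omega, contNum_vRat_two_mul hk, contDen_vRat_two_mul hk,
    contNum_vRat_two_mul_sub_one hk] at h
  have h1 := congrArg (eval 1) h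
  simp only [eval_mul, eval_C, eval_pow, eval_sub, eval_X, eval_one, eval_neg] at h1
  rw [one_pow, sub_self, zero_pow (by omega), pow_mul, neg_one_sq, one_pow] at h1
  have h2 := two_mul_thetaRat_mul_eval hk
  have h3 : ((-1 : ℚ) ^ k) * (-1) ^ k = 1 := by
    rw [← mul_pow]
    norm_num
  rw [mul_div_assoc] at h1
  set q := eval 1 (QkRat k)
  set w := vRat k 1 / vRat k (2 * k)
  have h4 : w * q ^ 2 = -1 := by linear_combination -h1 - w * q ^ 2 * h3
  linear_combination (2 * k * thetaRat k) ^ 2 * h4 - w * (2 * k * thetaRat k * q - 1) * h2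

end Rational

/-! ### Reduction modulo `p` -/

section Reduction

lemma memE.two_mul_add_one {p t k : ℕ} (hp : p.Prime) (hodd : p ≠ 2) (ht : 1 ≤ t)
    (hk : memE p t k) :
    1 ≤ k ∧ 2 * k < p ^ t ∧ ∃ m l, 2 * m + 1 ≤ p ∧ 2 * k + 1 = (2 * m + 1) * p ^ l := by
  obtain ⟨m, l, hm, hmp, hl, rfl⟩ := hk
  obtain ⟨c, hc⟩ := (hp.odd_of_ne_two hodd).pow (n := l)
  have hpl : 1 ≤ p ^ l := Nat.one_le_pow _ _ hp.pos
  have h1 : 2 * (m * p ^ l + (p ^ l - 1) / 2) + 1 = (2 * m + 1) * p ^ l := by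
    rw [hc, show (2 * c + 1 - 1) / 2 = c by omega]
    ring
  have h2 : 2 * m + 1 ≤ p := by
    have := hp.two_le
    omega
  refine ⟨?_, ?_, m, l, h2, h1⟩
  · have := Nat.mul_le_mul hm hpl
    omega
  · have h3 : (2 * m + 1) * p ^ l ≤ p ^ t := by
      calc (2 * m + 1) * p ^ l ≤ p * p ^ l := Nat.mul_le_mul_right _ h2
        _ = p ^ (l + 1) := by ring
        _ ≤ p ^ t := Nat.pow_le_pow_right hp.pos (by omega)
    omega

lemma padicValuation_sub_mul {p m l j x : ℕ} [hp : Fact p.Prime] (hodd : p ≠ 2)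
    (hm : 2 * m + 1 ≤ p) (hj : 1 ≤ j) (hjl : j < (2 * m + 1) * p ^ l) (hx : x = 1 ∨ x = 2) :
    Rat.padicValuation p ((2 * m + 1) * p ^ l - x * j) = Rat.padicValuation p j := by
  obtain ⟨e, c, hc, rfl⟩ := Nat.exists_eq_pow_mul_and_not_dvd (n := j) (by omega) p hp.out.ne_one
  have hp3 : 3 ≤ p := by
    have := hp.out.two_le
    omega
  have hel : e ≤ l := by
    by_contra h
    have h1 : p ^ (l + 1) ≤ p ^ e := Nat.pow_le_pow_right hp.out.pos (by omega)
    have h2 : p ^ e ≤ p ^ e * c := Nat.le_mul_of_pos_right _ (by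
      rcases Nat.eq_zero_or_pos c with rfl | h
      · simp at hc
      · exact h)
    have h3 : (2 * m + 1) * p ^ l ≤ p * p ^ l := Nat.mul_le_mul_right _ hm
    rw [pow_succ'] at h1
    omega
  have hd : ¬ (p : ℤ) ∣ (2 * m + 1) * p ^ (l - e) - x * c := by
    rcases hel.eq_or_lt with rfl | hlt
    · have h1 : c < 2 * m + 1 := by
        rw [mul_comm] at hjl
        exact lt_of_mul_lt_mul_right' hjl
      have h2 : 1 ≤ c := Nat.pos_of_ne_zero fun h => hc (h ▸ dvd_zero p)
      intro h
      have h3 := Int.eq_zero_of_abs_lt_dvd h (by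
        rw [Nat.sub_self, pow_zero, mul_one, abs_lt]
        rcases hx with rfl | rfl <;> push_cast <;> constructor <;> linarith)
      rw [Nat.sub_self, pow_zero, mul_one] at h3
      rcases hx with rfl | rfl <;> push_cast at h3 <;> omega
    · intro h
      have h1 : (p : ℤ) ∣ (2 * m + 1) * p ^ (l - e) :=
        (dvd_pow_self _ (by omega)).mul_left _
      have h2 : (p : ℤ) ∣ ((x * c : ℕ) : ℤ) := by
        have := dvd_sub h1 h
        rw [sub_sub_cancel] at this
        exact_mod_cast this
      rcases (Nat.Prime.dvd_mul hp.out).1 (Int.natCast_dvd_natCast.1 h2) with h3 | h3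
      · have := Nat.le_of_dvd (by omega) h3
        omega
      · exact hc h3
  have h1 : ((2 * m + 1) * p ^ l - x * (p ^ e * c : ℕ) : ℚ) =
      p ^ e * (((2 * m + 1) * p ^ (l - e) - x * c : ℤ) : ℚ) := by
    obtain ⟨f, rfl⟩ := Nat.exists_eq_add_of_le hel
    rw [Nat.add_sub_cancel_left, pow_add]
    push_cast
    ring
  have h2 : Rat.padicValuation p (c : ℚ) = 1 := by
    have := (Int.padicValuation_eq_one_iff (p := p) (x := c)).2
      (by rwa [Int.natCast_dvd_natCast])
    rw [← Rat.padicValuation_cast] at this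
    exact_mod_cast this
  rw [h1, map_mul, Rat.padicValuation_cast, Int.padicValuation_eq_one_iff.2 hd, Nat.cast_mul,
    map_mul, h2, Nat.cast_pow]

lemma padicValuation_vRat {p t k j : ℕ} [hp : Fact p.Prime] (hodd : p ≠ 2) (ht : 1 ≤ t)
    (hk : memE p t k) (hj : 1 ≤ j) (hjk : j ≤ 2 * k) : Rat.padicValuation p (vRat k j) = 1 := by
  obtain ⟨-, -, m, l, hm, hml⟩ := hk.two_mul_add_one hp.out hodd ht
  have key : ∀ x i : ℕ, x = 1 ∨ x = 2 → 1 ≤ i → i ≤ 2 * k →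
      Rat.padicValuation p (2 * k + 1 - x * i) = Rat.padicValuation p i := by
    intro x i hx hi hik
    rw [← padicValuation_sub_mul (l := l) hodd hm hi (by omega) hx]
    congr 2
    exact_mod_cast hml
  induction j with
  | zero => omega
  | succ j ih =>
    rcases j with _ | j
    · have h := key 2 1 (by simp) le_rfl (by omega)
      rw [Nat.cast_one, map_one] at h
      rw [← h, vRat]
      congr 1
      push_cast
      ring
    · have h1 := key 2 (j + 1) (by simp) (by omega) (by omega)
      have h2 := key 2 (j + 2) (by simp) (by omega) (by omega)
      have h3 := key 1 (j + 2) (by simp) (by omega) (by omega)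
      have n1 : Rat.padicValuation p ((j + 1 : ℕ) : ℚ) ≠ 0 := by
        rw [ne_eq, Rat.padicValuation_eq_zero_iff]
        positivity
      have n2 : Rat.padicValuation p ((j + 2 : ℕ) : ℚ) ≠ 0 := by
        rw [ne_eq, Rat.padicValuation_eq_zero_iff]
        positivity
      rw [vRat, map_div₀, ih (by omega) (by omega), div_one, map_div₀, map_mul, map_mul]
      rw [show (2 * k - 2 * ((j : ℚ) + 1) - 1) = 2 * k + 1 - (2 : ℕ) * (j + 2 : ℕ) by
          push_cast; ring, h2,
        show (2 * k - 2 * ((j : ℚ) + 1) + 1) = 2 * k + 1 - (2 : ℕ) * (j + 1 : ℕ) by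
          push_cast; ring, h1,
        show (2 * k - ((j : ℚ) + 1)) = 2 * k + 1 - (1 : ℕ) * (j + 2 : ℕ) by
          push_cast; ring, h3, show ((j : ℚ) + 1) = (j + 1 : ℕ) by push_cast; ring]
      rw [mul_comm, div_self (mul_ne_zero n1 n2)]

/-- The reduction of `p`-integral rationals in a field of characteristic `p`. -/
def padicReduction (p : ℕ) [Fact p.Prime] (F : Type*) [Field F] [CharP F p] :
    (Rat.padicValuation p).integer →+* F where
  toFun x := ((x : ℚ) : F)
  map_one' := by simp
  map_zero' := by simp
  map_mul' x y := by
    have h : ∀ z : (Rat.padicValuation p).integer, ((z : ℚ).den : F) ≠ 0 := fun z => by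
      rw [ne_eq, CharP.cast_eq_zero_iff F p]
      exact Rat.padicValuation_le_one_iff.1 z.2
    exact Rat.cast_mul_of_ne_zero (h x) (h y)
  map_add' x y := by
    have h : ∀ z : (Rat.padicValuation p).integer, ((z : ℚ).den : F) ≠ 0 := fun z => by
      rw [ne_eq, CharP.cast_eq_zero_iff F p]
      exact Rat.padicValuation_le_one_iff.1 z.2
    exact Rat.cast_add_of_ne_zero (h x) (h y)

/-- The polynomial `Q_k` over a field of characteristic `p`. -/
def QkF (F : Type*) [Field F] (k : ℕ) : F[X] :=
  ∑ i ∈ Finset.range k, C (bRat k i : F) * X ^ (2 * i + 1)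

lemma QkRat_coeff {k i : ℕ} (hi : i < k) : (QkRat k).coeff (2 * i + 1) = bRat k i := by
  rw [QkRat, finsetSum_coeff, Finset.sum_eq_single i]
  · rw [coeff_C_mul_X_pow, if_pos rfl]
  · intro j _ hj
    rw [coeff_C_mul_X_pow, if_neg (by omega)]
  · intro h
    exact absurd (Finset.mem_range.2 hi) h

/-- The continuants of `v_1 T, …, v_{2k} T` over a field of characteristic `p`, and the
properties of `Q_k`, `θ_k`, `ω_k` and `v_j` that survive reduction. -/
lemma contNum_vF {p t k : ℕ} (hp : p.Prime) (hodd : p ≠ 2) (ht : 1 ≤ t) (hk : memE p t k)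
    (F : Type*) [Field F] [CharP F p] :
    contNum (fun j => C (vF F k j) * X) (2 * k) = C ((-1) ^ k) * (X ^ 2 - 1) ^ k ∧
    contDen (fun j => C (vF F k j) * X) (2 * k) = C ((-1) ^ k) * QkF F k ∧
    contNum (fun j => C (vF F k j) * X) (2 * k - 1) =
      C (-(-1) ^ k * (2 * k * thF F k) ^ 2) * QkF F k ∧
    2 * k * thF F k * (QkF F k).eval 1 = -1 ∧
    omF F k * (2 * k * thF F k) ^ 2 = -1 ∧
    derivative (QkF F k) = (X ^ 2 - 1) ^ (k - 1) ∧
    ∀ j, 1 ≤ j → j ≤ 2 * k → vF F k j ≠ 0 := by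
  have : Fact p.Prime := ⟨hp⟩
  have hk1 := (hk.two_mul_add_one hp hodd ht).1
  have hv : ∀ {j}, 1 ≤ j → j ≤ 2 * k → Rat.padicValuation p (vRat k j) = 1 := fun h1 h2 =>
    padicValuation_vRat hodd ht hk h1 h2
  set A := (Rat.padicValuation p).integer with hA
  set φ := padicReduction p F
  have hι : Function.Injective (mapRingHom A.subtype) :=
    map_injective _ Subtype.val_injective
  -- lifts to the ring of `p`-integral rationals
  obtain ⟨w, hw⟩ : ∃ w : ℕ → A, ∀ j, 1 ≤ j → j ≤ 2 * k → (w j : ℚ) = vRat k j := by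
    refine ⟨fun j => if h : 1 ≤ j ∧ j ≤ 2 * k then ⟨vRat k j, (hv h.1 h.2).le⟩ else 0, ?_⟩
    intro j h1 h2
    simp [h1, h2]
  have hwι : ∀ j, 1 ≤ j → j ≤ 2 * k →
      mapRingHom A.subtype (C (w j) * X) = C (vRat k j) * X := by
    intro j h1 h2
    simp [hw j h1 h2]
  have hwφ : ∀ j, 1 ≤ j → j ≤ 2 * k → mapRingHom φ (C (w j) * X) = C (vF F k j) * X := by
    intro j h1 h2
    have : φ (w j) = vF F k j := by
      rw [vF, ← hw j h1 h2]
      rfl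
    simp [this]
  have hD := contDen_vRat_two_mul hk1
  rw [← contDen_congr hwι, ← map_contDen] at hD
  obtain ⟨b, hb⟩ : ∃ b : ℕ → A, ∀ i, i < k → (b i : ℚ) = bRat k i := by
    refine ⟨fun i => (-1) ^ k * (contDen (fun j => C (w j) * X) (2 * k)).coeff (2 * i + 1), ?_⟩
    intro i hi
    have h1 := congrArg (fun q => coeff q (2 * i + 1)) hD
    rw [coe_mapRingHom, coeff_map, coeff_C_mul, QkRat_coeff hi] at h1
    have h2 : ((-1 : ℚ) ^ k) * (-1) ^ k = 1 := by
      rw [← mul_pow]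
      norm_num
    have h3 : (((-1) ^ k : A) : ℚ) = (-1) ^ k := by simp
    rw [Subring.coe_mul, h3]
    change (-1) ^ k * A.subtype _ = _
    rw [h1, ← mul_assoc, h2, one_mul]
  set Q : A[X] := ∑ i ∈ Finset.range k, C (b i) * X ^ (2 * i + 1) with hQ
  have hQι : mapRingHom A.subtype Q = QkRat k := by
    rw [hQ, map_sum, QkRat]
    refine Finset.sum_congr rfl fun i hi => ?_
    simp [hb i (Finset.mem_range.1 hi)]
  have hQφ : mapRingHom φ Q = QkF F k := by
    rw [hQ, map_sum, QkF]
    refine Finset.sum_congr rfl fun i hi => ?_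
    have : φ (b i) = bRat k i := by
      rw [← hb i (Finset.mem_range.1 hi)]
      rfl
    simp [this]
  obtain ⟨th, hth⟩ : ∃ x : A, (x : ℚ) = thetaRat k := by
    refine ⟨⟨thetaRat k, ?_⟩, rfl⟩
    have h2 : Rat.padicValuation p 2 = 1 := by
      have := (Int.padicValuation_eq_one_iff (p := p) (x := 2)).2 fun h => hodd
        ((Nat.prime_dvd_prime_iff_eq hp Nat.prime_two).1 (by exact_mod_cast h))
      rw [← Rat.padicValuation_cast] at this
      exact_mod_cast this
    rw [Valuation.mem_integer_iff, thetaRat, map_mul, map_mul, map_pow, Valuation.map_neg, map_one,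
      one_pow, one_mul, map_inv₀, map_pow, h2, one_pow, inv_one, one_mul]
    have := Int.padicValuation_le_one p ((2 * k).choose k : ℕ)
    rw [← Rat.padicValuation_cast] at this
    exact_mod_cast this
  have hthφ : φ th = thF F k := by
    rw [thF, ← hth]
    rfl
  have hκ : Rat.padicValuation p (2 * k * thetaRat k) = 1 := by
    have h := congrArg (Rat.padicValuation p) (vRat_one_div hk1)
    rw [map_div₀, hv le_rfl (by omega), hv (by omega) le_rfl, Valuation.map_neg, map_pow,
      div_one] at h
    exact (pow_eq_one_iff_of_nonneg zero_le two_ne_zero).1 h.symm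
  have hκ0 : (2 * k * thetaRat k : ℚ) ≠ 0 := by
    intro h
    rw [h, map_zero] at hκ
    exact zero_ne_one hκ
  obtain ⟨om, hom⟩ : ∃ x : A, (x : ℚ) = omegaRat k := by
    refine ⟨⟨omegaRat k, ?_⟩, rfl⟩
    rw [Valuation.mem_integer_iff, omegaRat, Valuation.map_neg, map_pow, map_inv₀, hκ, inv_one,
      one_pow]
  have homφ : φ om = omF F k := by
    rw [omF, ← hom]
    rfl
  have h2ι : ((2 : A) : ℚ) = 2 := rfl
  have h2φ : φ 2 = 2 := map_ofNat φ 2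
  refine ⟨?_, ?_, ?_, ?_, ?_, ?_, ?_⟩
  · rw [← contNum_congr hwφ, ← map_contNum]
    have h : contNum (fun j => C (w j) * X) (2 * k) = C ((-1) ^ k) * (X ^ 2 - 1) ^ k := by
      apply hι
      rw [map_contNum, contNum_congr hwι, contNum_vRat_two_mul hk1]
      simp
    rw [h]
    simp
  · rw [← contDen_congr hwφ, ← map_contDen]
    have h : contDen (fun j => C (w j) * X) (2 * k) = C ((-1) ^ k) * Q := by
      apply hι
      rw [hD, map_mul, hQι]
      simp
    rw [h, map_mul, hQφ]
    simp
  · rw [← contNum_congr fun j h1 h2 => hwφ j h1 (by omega), ← map_contNum]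
    have h : contNum (fun j => C (w j) * X) (2 * k - 1) =
        C (-(-1) ^ k * (2 * k * th) ^ 2) * Q := by
      apply hι
      rw [map_contNum, contNum_congr fun j h1 h2 => hwι j h1 (by omega),
        contNum_vRat_two_mul_sub_one hk1, map_mul, hQι, mul_div_assoc, vRat_one_div hk1]
      simp [hth, h2ι]
    rw [h, map_mul, hQφ]
    simp [hthφ, h2φ]
  · have h : 2 * k * th * Q.eval 1 = -1 := by
      apply Subtype.val_injective
      have := two_mul_thetaRat_mul_eval hk1
      rw [← hQι, coe_mapRingHom, eval_one_map] at this
      simpa [hth, h2ι] using this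
    have h2 := congrArg φ h
    rw [map_mul, ← eval_one_map, ← coe_mapRingHom, hQφ] at h2
    simpa [hthφ, h2φ] using h2
  · have h : om * (2 * k * th) ^ 2 = -1 := by
      apply Subtype.val_injective
      have : omegaRat k * (2 * k * thetaRat k) ^ 2 = -1 := by
        rw [omegaRat, inv_pow, neg_mul, inv_mul_cancel₀ (pow_ne_zero 2 hκ0)]
      simpa [hth, hom, h2ι] using this
    have h2 := congrArg φ h
    simpa [hthφ, homφ, h2φ] using h2
  · have h : derivative Q = (X ^ 2 - 1) ^ (k - 1) := by
      apply hι
      rw [coe_mapRingHom, ← derivative_map, ← coe_mapRingHom, hQι, derivative_QkRat hk1]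
      simp
    rw [← hQφ, coe_mapRingHom, derivative_map, h]
    simp
  · intro j h1 h2
    have hu : IsUnit (w j) := by
      refine (Valuation.integer.integers _).isUnit_iff_valuation_eq_one.2 ?_
      change Rat.padicValuation p (w j : ℚ) = 1
      rw [hw j h1 h2, hv h1 h2]
    have h3 : φ (w j) = vF F k j := by
      rw [vF, ← hw j h1 h2]
      rfl
    rw [← h3]
    exact (hu.map φ).ne_zero

end Reduction

/-! ### The polynomials `A_i` -/

section Aseq

variable {F : Type*} [Field F]

lemma eval_neg_one_QkF (k : ℕ) : (QkF F k).eval (-1) = -(QkF F k).eval 1 := by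
  simp only [QkF, eval_finsetSum, ← Finset.sum_neg_distrib]
  refine Finset.sum_congr rfl fun i _ => ?_
  simp [pow_succ, pow_mul]

lemma natDegree_QkF_lt {k : ℕ} (hk : 1 ≤ k) : (QkF F k).natDegree < 2 * k := by
  have : (QkF F k).natDegree ≤ 2 * k - 1 := by
    refine natDegree_sum_le_of_forall_le _ _ fun i hi => ?_
    have := Finset.mem_range.1 hi
    exact (natDegree_C_mul_X_pow_le _ _).trans (by omega)
  omega

lemma monic_sq_sub_one_pow (k : ℕ) : ((X ^ 2 - 1 : F[X]) ^ k).Monic :=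
  (monic_X_pow_sub_C (1 : F) two_ne_zero).pow k

lemma natDegree_sq_sub_one_pow (k : ℕ) : ((X ^ 2 - 1 : F[X]) ^ k).natDegree = 2 * k := by
  rw [natDegree_pow, ← C_1, natDegree_X_pow_sub_C, mul_comm]

/-- Division by `P_k` with remainder a multiple of `Q_k`. -/
lemma div_eq_of_eq_sub_QkF {k : ℕ} (hk : 1 ≤ k) {f g : F[X]} {c : F}
    (h : f = (X ^ 2 - 1) ^ k * g - C c * QkF F k) : f / (X ^ 2 - 1) ^ k = g := by
  rw [← divByMonic_eq_div _ (monic_sq_sub_one_pow k)]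
  refine (div_modByMonic_unique g (-(C c * QkF F k)) (monic_sq_sub_one_pow k)
    ⟨by rw [h]; ring, ?_⟩).1
  rw [degree_neg]
  refine degree_lt_degree ?_
  rw [natDegree_sq_sub_one_pow]
  exact (natDegree_C_mul_le _ _).trans_lt (natDegree_QkF_lt hk)

lemma one_le_natDegree_Aseq {p t k : ℕ} (hp : p.Prime) (hodd : p ≠ 2) (ht : 1 ≤ t) (hk : memE p t k) {i : ℕ}
    (hi : 1 ≤ i) : 1 ≤ (Aseq F (p ^ t) k i).natDegree := by
  obtain ⟨hk1, hkt, -⟩ := hk.two_mul_add_one hp hodd ht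
  induction i, hi using Nat.le_induction with
  | base => simp [Aseq]
  | succ i hi ih =>
    obtain ⟨i, rfl⟩ : ∃ j, i = j + 1 := ⟨i - 1, by omega⟩
    rw [Aseq, ← divByMonic_eq_div _ (monic_sq_sub_one_pow k),
      natDegree_divByMonic _ (monic_sq_sub_one_pow k), natDegree_sq_sub_one_pow, natDegree_pow]
    have := Nat.mul_le_mul_left (p ^ t) ih
    omega

variable {p t k : ℕ} [CharP F p]

lemma exists_X_pow_eq (hp : p.Prime) (hodd : p ≠ 2) (ht : 1 ≤ t) (hk : memE p t k) :
    ∃ B : F[X], X ^ p ^ t = (X ^ 2 - 1) ^ k * B - C (2 * k * thF F k) * QkF F k := by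
  have : Fact p.Prime := ⟨hp⟩
  obtain ⟨hk1, hkt, -⟩ := hk.two_mul_add_one hp hodd ht
  obtain ⟨h1, h2, h3, h4, -, -, -⟩ := contNum_vF hp hodd ht hk F
  have hdet := contNum_mul_contDen_sub (fun j => C (vF F k j) * X) (2 * k - 1)
  rw [show 2 * k - 1 + 1 = 2 * k by omega, h1, h2, h3] at hdet
  set κ := 2 * k * thF F k with hκ
  set D := contDen (fun j => C (vF F k j) * X) (2 * k - 1)
  set Q := QkF F k
  have hs : (C ((-1 : F) ^ k)) * C ((-1) ^ k) = 1 := by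
    rw [← C_mul, ← C_1, ← mul_pow]
    norm_num
  rw [pow_mul, neg_one_sq, one_pow] at hdet
  have hsq : (1 + C κ * Q) * (1 - C κ * Q) = (X - 1) ^ k * (X + 1) ^ k * (C ((-1) ^ k) * D) := by
    rw [← mul_pow, show (X - 1 : F[X]) * (X + 1) = X ^ 2 - 1 by ring]
    have hc : C (-(-1) ^ k * κ ^ 2) = -C ((-1) ^ k) * C κ ^ 2 := by
      rw [C_mul, C_neg, C_pow (a := κ)]
    rw [hc] at hdet
    linear_combination (C κ ^ 2 * Q ^ 2) * hs - hdet
  have hκ2 : (2 : F) ≠ 0 := fun h => by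
    rw [hκ, h] at h4
    simp at h4
  have co1 : IsCoprime ((X - 1 : F[X]) ^ k) (1 - C κ * Q) := by
    refine IsCoprime.pow_left ?_
    rw [← C_1, (irreducible_X_sub_C (1 : F)).coprime_iff_not_dvd, dvd_iff_isRoot]
    simp only [IsRoot.def, C_1, eval_sub, eval_one, eval_mul, eval_C, h4]
    intro h
    exact hκ2 (by linear_combination h)
  have co2 : IsCoprime ((X + 1 : F[X]) ^ k) (1 + C κ * Q) := by
    refine IsCoprime.pow_left ?_
    rw [← sub_neg_eq_add X, ← C_1, ← C_neg, (irreducible_X_sub_C (-1 : F)).coprime_iff_not_dvd,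
      dvd_iff_isRoot]
    simp only [IsRoot.def, C_1, eval_add, eval_one, eval_mul, eval_C, Q, eval_neg_one_QkF, mul_neg,
      h4]
    intro h
    exact hκ2 (by linear_combination h)
  have d1 : (X - 1 : F[X]) ^ k ∣ 1 + C κ * Q :=
    co1.dvd_of_dvd_mul_right (Dvd.intro _ (by rw [hsq, mul_assoc]))
  have d2 : (X + 1 : F[X]) ^ k ∣ 1 - C κ * Q :=
    co2.dvd_of_dvd_mul_left
      (Dvd.intro ((X - 1) ^ k * (C ((-1) ^ k) * D)) (by rw [hsq]; ring))
  have e1 : (X - 1 : F[X]) ^ k ∣ X ^ p ^ t - 1 := by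
    have := sub_pow_char_pow (R := F[X]) (p := p) X 1 (n := t)
    rw [one_pow] at this
    rw [← this]
    exact pow_dvd_pow _ (by omega)
  have e2 : (X + 1 : F[X]) ^ k ∣ X ^ p ^ t + 1 := by
    have := add_pow_char_pow (R := F[X]) (p := p) X 1 (n := t)
    rw [one_pow] at this
    rw [← this]
    exact pow_dvd_pow _ (by omega)
  have co3 : IsCoprime ((X - 1 : F[X]) ^ k) ((X + 1) ^ k) := by
    refine IsCoprime.pow ⟨-C (1 / 2), C (1 / 2), ?_⟩
    have : C (1 / 2 : F) * 2 = 1 := by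
      rw [← C_ofNat, ← C_mul, ← C_1]
      congr 1
      field_simp
    linear_combination this
  have hdvd : (X ^ 2 - 1 : F[X]) ^ k ∣ X ^ p ^ t + C κ * Q := by
    rw [show (X ^ 2 - 1 : F[X]) = (X - 1) * (X + 1) by ring, mul_pow]
    refine co3.mul_dvd ?_ ?_
    · have := dvd_add e1 d1
      convert this using 1
      ring
    · have := dvd_sub e2 d2
      convert this using 1
      ring
  obtain ⟨B, hB⟩ := hdvd
  exact ⟨B, by rw [← hB]; ring⟩

lemma thF_pow (k t : ℕ) (hp : p.Prime) : thF F k ^ p ^ t = thF F k := by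
  have : ExpChar F p := .prime hp
  have := map_ratCast (iterateFrobenius F p t) (thetaRat k)
  rwa [iterateFrobenius_def] at this

lemma Aseq_succ_pow_eval (hp : p.Prime) (hodd : p ≠ 2) (ht : 1 ≤ t) (hk : memE p t k) (i : ℕ) :
    Aseq F (p ^ t) k (i + 1) ^ p ^ t = (X ^ 2 - 1) ^ k * Aseq F (p ^ t) k (i + 2) -
        C (2 * k * thF F k ^ (i + 1)) * QkF F k ∧
      (Aseq F (p ^ t) k (i + 2)).eval 1 = thF F k ^ (i + 1) ∧
      (Aseq F (p ^ t) k (i + 2)).eval (-1) = -thF F k ^ (i + 1) := by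
  have : Fact p.Prime := ⟨hp⟩
  obtain ⟨hk1, hkt, -⟩ := hk.two_mul_add_one hp hodd ht
  obtain ⟨-, -, -, h4, -, hQ', -⟩ := contNum_vF hp hodd ht hk F
  obtain ⟨B, hB⟩ := exists_X_pow_eq (F := F) hp hodd ht hk
  have hk2 : (2 * k : F) ≠ 0 := fun h => by
    rw [h] at h4
    simp at h4
  have hBe : 2 * (k : F[X]) * X * B + (X ^ 2 - 1) * derivative B = C (2 * k * thF F k) := by
    have hd := congrArg derivative hB
    rw [derivative_X_pow, derivative_sub, derivative_mul, derivative_C_mul, hQ',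
      derivative_pow] at hd
    have hr : ((p ^ t : ℕ) : F) = 0 := by
      rw [Nat.cast_pow, CharP.cast_eq_zero, zero_pow (by omega)]
    rw [hr, C_0, zero_mul] at hd
    refine mul_left_cancel₀ (monic_sq_sub_one_pow (F := F) (k - 1)).ne_zero ?_
    have hpk : (X ^ 2 - 1 : F[X]) ^ k = (X ^ 2 - 1) ^ (k - 1) * (X ^ 2 - 1) := by
      rw [← pow_succ, Nat.sub_add_cancel hk1]
    rw [hpk] at hd
    simp only [derivative_sub, derivative_X_pow, derivative_one, Nat.cast_ofNat, C_ofNat,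
      Nat.add_one_sub_one, pow_one, sub_zero, C_eq_natCast] at hd
    linear_combination -hd
  have hB1 : B.eval 1 = thF F k := by
    have := congrArg (eval 1) hBe
    simp only [eval_add, eval_mul, eval_ofNat, eval_natCast, eval_X, eval_sub, eval_pow, eval_one,
      eval_C] at this
    exact mul_left_cancel₀ hk2 (by linear_combination this)
  have hB2 : B.eval (-1) = -thF F k := by
    have := congrArg (eval (-1)) hBe
    simp only [eval_add, eval_mul, eval_ofNat, eval_natCast, eval_X, eval_sub, eval_pow, eval_one,
      eval_C] at this
    exact mul_left_cancel₀ hk2 (by linear_combination -this)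
  have step : ∀ i, (Aseq F (p ^ t) k (i + 1)).eval 1 = thF F k ^ i →
      (Aseq F (p ^ t) k (i + 1)).eval (-1) = -thF F k ^ i →
      Aseq F (p ^ t) k (i + 1) ^ p ^ t = (X ^ 2 - 1) ^ k * Aseq F (p ^ t) k (i + 2) -
        C (2 * k * thF F k ^ (i + 1)) * QkF F k ∧
      (Aseq F (p ^ t) k (i + 2)).eval 1 = thF F k ^ (i + 1) ∧
      (Aseq F (p ^ t) k (i + 2)).eval (-1) = -thF F k ^ (i + 1) := by
    intro i he1 he2
    set A := Aseq F (p ^ t) k (i + 1) with hA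
    set θ := thF F k
    have hdvd : (X ^ 2 - 1 : F[X]) ∣ A - C (θ ^ i) * X := by
      have c : IsCoprime (X - C (1 : F)) (X - C (-1)) := by
        refine isCoprime_X_sub_C_of_isUnit_sub ?_
        rw [sub_neg_eq_add, one_add_one_eq_two]
        exact (left_ne_zero_of_mul hk2).isUnit
      have : (X ^ 2 - 1 : F[X]) = (X - C (1 : F)) * (X - C (-1)) := by
        rw [C_neg, C_1]
        ring
      rw [this]
      refine c.mul_dvd (dvd_iff_isRoot.2 ?_) (dvd_iff_isRoot.2 ?_)
      · simp [he1]
      · simp [he2]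
    obtain ⟨E, hE⟩ := hdvd
    have hAr : A ^ p ^ t = (X ^ 2 - 1) ^ k * (C (θ ^ i) * B + (X ^ 2 - 1) ^ (p ^ t - k) * E ^ p ^ t)
        - C (2 * k * θ ^ (i + 1)) * QkF F k := by
      have h1 := congrArg (· ^ p ^ t) hE
      rw [sub_pow_char_pow, mul_pow, mul_pow] at h1
      have h2 : C (θ ^ i) ^ p ^ t = C (θ ^ i) := by
        rw [← C_pow, ← pow_mul, mul_comm, pow_mul, thF_pow k t hp]
      rw [h2, hB] at h1
      have h3 : (X ^ 2 - 1 : F[X]) ^ p ^ t = (X ^ 2 - 1) ^ k * (X ^ 2 - 1) ^ (p ^ t - k) := by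
        rw [← pow_add]
        congr 1
        omega
      rw [h3] at h1
      have h4 : (C (2 * k * θ ^ (i + 1)) : F[X]) = C (θ ^ i) * C (2 * k * θ) := by
        rw [← C_mul]
        congr 1
        ring
      rw [h4]
      linear_combination h1
    have hdiv := div_eq_of_eq_sub_QkF hk1 hAr
    have hA2 : Aseq F (p ^ t) k (i + 2) = A ^ p ^ t / (X ^ 2 - 1) ^ k := rfl
    rw [hA2, hdiv]
    have hne : p ^ t - k ≠ 0 := by omega
    refine ⟨hAr, ?_, ?_⟩
    · simp [hB1, hne, pow_succ]
    · simp [hB2, hne, pow_succ]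
  induction i with
  | zero => exact step 0 (by simp [Aseq]) (by simp [Aseq])
  | succ i ih => exact step (i + 1) ih.2.1 ih.2.2

lemma Aseq_pow (hp : p.Prime) (hodd : p ≠ 2) (ht : 1 ≤ t) (hk : memE p t k) {i : ℕ}
    (hi : 1 ≤ i) :
    Aseq F (p ^ t) k i ^ p ^ t = (X ^ 2 - 1) ^ k * Aseq F (p ^ t) k (i + 1) -
        C (2 * k * thF F k ^ i) * QkF F k := by
  obtain ⟨i, rfl⟩ : ∃ j, i = j + 1 := ⟨i - 1, by omega⟩
  exact (Aseq_succ_pow_eval hp hodd ht hk i).1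

end Aseq

/-! ### Polynomials in the field of Laurent series -/

section PolynomialValuation

open WithZero

variable {F : Type*} [Field F]

lemma one_lt_valuation_Tvar : 1 < Valued.v (Tvar F) := by
  rw [Tvar, LaurentSeries.valuation_single_zpow, neg_neg, ← exp_zero, exp_lt_exp]
  exact one_pos

lemma valuation_algebraMap {c : F} (hc : c ≠ 0) :
    Valued.v (algebraMap F (LaurentSeries F) c) = 1 := by
  have le : ∀ c : F, Valued.v (algebraMap F (LaurentSeries F) c) ≤ 1 := by
    intro c
    rw [← exp_zero, ← neg_zero, LaurentSeries.valuation_le_iff_coeff_lt_eq_zero]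
    intro n hn
    rw [HahnSeries.algebraMap_apply', PowerSeries.algebraMap_apply, HahnSeries.ofPowerSeries_C,
      HahnSeries.C_apply, HahnSeries.coeff_single_of_ne hn.ne]
  refine (le c).antisymm ?_
  have h1 := le c⁻¹
  rw [map_inv₀, map_inv₀] at h1
  have h0 : Valued.v (algebraMap F (LaurentSeries F) c) ≠ 0 := by simpa using hc
  exact (inv_le_one₀ (zero_lt_iff.2 h0)).1 h1

lemma valuation_Tvar_le {α : LaurentSeries F} (h0 : α ≠ 0) (h : α.order ≤ -1) :
    Valued.v (Tvar F) ≤ Valued.v α := by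
  by_contra! hlt
  have h1 : Valued.v α ≤ exp (-(0 : ℤ)) := by
    rw [Tvar, LaurentSeries.valuation_single_zpow, neg_neg] at hlt
    rw [neg_zero]
    have hα : Valued.v α ≠ 0 := by simpa using h0
    rw [← exp_log hα, exp_lt_exp] at hlt
    rw [← exp_log hα, exp_le_exp]
    omega
  have h2 := LaurentSeries.valuation_le_iff_coeff_lt_eq_zero F |>.1 h1 α.order (by omega)
  exact h0 (HahnSeries.coeff_order_eq_zero.1 h2)

lemma valuation_polyT_le (P : F[X]) :
    Valued.v (polyT F P) ≤ Valued.v (Tvar F) ^ P.natDegree := by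
  rw [polyT, aeval_eq_sum_range]
  refine Valuation.map_sum_le _ fun i hi => ?_
  have hi : i ≤ P.natDegree := Nat.lt_succ_iff.1 (Finset.mem_range.1 hi)
  rw [Algebra.smul_def, map_mul, map_pow]
  rcases eq_or_ne (P.coeff i) 0 with h | h
  · rw [h]
    simp
  · rw [valuation_algebraMap h, one_mul]
    exact pow_le_pow_right₀ one_lt_valuation_Tvar.le hi

lemma polyT_C_mul (c : F) (P : F[X]) :
    polyT F (C c * P) = algebraMap F (LaurentSeries F) c * polyT F P := by
  rw [polyT, map_mul, aeval_C, polyT]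

lemma valuation_polyT {P : F[X]} (hP : P ≠ 0) :
    Valued.v (polyT F P) = Valued.v (Tvar F) ^ P.natDegree := by
  have hlead : Valued.v (polyT F (C P.leadingCoeff * X ^ P.natDegree)) =
      Valued.v (Tvar F) ^ P.natDegree := by
    rw [polyT_C_mul, map_mul, valuation_algebraMap (leadingCoeff_ne_zero.2 hP), one_mul, polyT,
      map_pow, aeval_X, map_pow]
  have hadd : polyT F P = polyT F P.eraseLead + polyT F (C P.leadingCoeff * X ^ P.natDegree) := by
    rw [polyT, polyT, polyT, ← map_add, eraseLead_add_C_mul_X_pow]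
  rw [hadd, Valuation.map_add_eq_of_lt_right, hlead]
  rw [hlead]
  rcases P.eraseLead_natDegree_lt_or_eraseLead_eq_zero with h | h
  · exact (valuation_polyT_le _).trans_lt (pow_lt_pow_right₀ one_lt_valuation_Tvar h)
  · rw [h, polyT, map_zero, map_zero]
    have h0 : (0 : ℤᵐ⁰) < Valued.v (Tvar F) := zero_lt_one.trans one_lt_valuation_Tvar
    exact pow_pos h0 _

lemma valuation_PkLS (k : ℕ) : Valued.v (PkLS F k) = Valued.v (Tvar F) ^ (2 * k) := by
  have h : PkLS F k = polyT F ((X ^ 2 - 1) ^ k) := by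
    simp [PkLS, polyT]
  rw [h, valuation_polyT (monic_sq_sub_one_pow k).ne_zero, natDegree_sq_sub_one_pow]

lemma QkLS_eq_polyT (k : ℕ) : QkLS F k = polyT F (QkF F k) := by
  simp [QkLS, polyT, QkF]

lemma valuation_QkLS_lt {k : ℕ} (hk : 1 ≤ k) :
    Valued.v (QkLS F k) < Valued.v (Tvar F) ^ (2 * k) := by
  rw [QkLS_eq_polyT]
  exact (valuation_polyT_le _).trans_lt
    (pow_lt_pow_right₀ one_lt_valuation_Tvar (natDegree_QkF_lt hk))

lemma valuation_aPQ {r k l : ℕ} {lam : ℕ → F} {n : ℕ} (hn : lam n ≠ 0)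
    (hA : 1 ≤ (Aseq F r k (iIdx k l n)).natDegree) :
    Valued.v (aPQ F r k l lam n) = Valued.v (Tvar F) ^ (Aseq F r k (iIdx k l n)).natDegree := by
  rw [aPQ, map_mul, valuation_algebraMap hn, one_mul, valuation_polyT]
  intro h
  rw [h] at hA
  simp at hA

lemma polyT_Aseq_pow {p t k : ℕ} [CharP F p] (hp : p.Prime) (hodd : p ≠ 2) (ht : 1 ≤ t)
    (hk : memE p t k) {i : ℕ} (hi : 1 ≤ i) :
    polyT F (Aseq F (p ^ t) k i) ^ p ^ t = PkLS F k * polyT F (Aseq F (p ^ t) k (i + 1)) -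
        algebraMap F (LaurentSeries F) (2 * k * thF F k ^ i) * QkLS F k := by
  have h := congrArg (aeval (Tvar F)) (Aseq_pow (F := F) hp hodd ht hk hi)
  rw [QkLS_eq_polyT, PkLS]
  simp only [map_pow, map_sub, map_mul, aeval_C, aeval_X, map_one] at h
  simpa only [map_pow, map_mul, polyT] using h

end PolynomialValuation

/-! ### The index functions -/

section Index

variable {k l : ℕ}

lemma fIdx_succ (n : ℕ) : fIdx k l (n + 1) = (2 * k + 1) * n + l + 1 := by
  rw [fIdx, mul_add]
  omega

lemma one_le_iIdx (n : ℕ) : 1 ≤ iIdx k l n := by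
  rw [iIdx]
  split_ifs <;> omega

lemma iIdx_of_le {n : ℕ} (hn : n ≤ l) : iIdx k l n = 1 := by
  rw [iIdx, dif_neg]
  rintro ⟨h, -, -⟩
  rw [Nat.le_div_iff_mul_le (by omega)] at h
  omega

lemma iIdx_fIdx_succ (hk : 1 ≤ k) (hl : 1 ≤ l) (n : ℕ) :
    iIdx k l (fIdx k l (n + 1)) = iIdx k l (n + 1) + 1 := by
  have h : (fIdx k l (n + 1) + 2 * k - l) / (2 * k + 1) = n + 1 := by
    rw [fIdx_succ, show (2 * k + 1) * n + l + 1 + 2 * k - l = (2 * k + 1) * (n + 1) by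
      rw [mul_add]; omega]
    exact Nat.mul_div_cancel_left _ (by omega)
  conv_lhs => rw [iIdx]
  rw [dif_pos, h]
  rw [h]
  refine ⟨by omega, rfl, ?_⟩
  rw [fIdx_succ]
  nlinarith

lemma iIdx_fIdx_add {i : ℕ} (n : ℕ) (hi : 1 ≤ i) (hik : i ≤ 2 * k) :
    iIdx k l (fIdx k l (n + 1) + i) = 1 := by
  rw [iIdx, dif_neg]
  rintro ⟨-, h, -⟩
  have hq : (fIdx k l (n + 1) + i + 2 * k - l) / (2 * k + 1) = n + 1 := by
    rw [fIdx_succ, show (2 * k + 1) * n + l + 1 + i + 2 * k - l = i + (2 * k + 1) * (n + 1) by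
      rw [mul_add]; omega, Nat.add_mul_div_left _ _ (by omega), Nat.div_eq_of_lt (by omega),
      zero_add]
  rw [hq] at h
  omega

end Index

/-! ### Continued fractions of type `(r, l, k)` -/

section TypeRLK

open WithZero

variable {F : Type*} [Field F]

lemma PkLS_ne_zero (k : ℕ) : PkLS F k ≠ 0 := by
  refine (Valuation.ne_zero_iff Valued.v).1 ?_
  rw [valuation_PkLS]
  exact pow_ne_zero _ (zero_lt_one.trans one_lt_valuation_Tvar).ne'

lemma valuation_algebraMap_mul_QkLS_lt {k : ℕ} (hk : 1 ≤ k) (η : F) :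
    Valued.v (algebraMap F (LaurentSeries F) η * QkLS F k) < Valued.v (Tvar F) ^ (2 * k) := by
  have hT0 : (0 : ℤᵐ⁰) < Valued.v (Tvar F) := zero_lt_one.trans one_lt_valuation_Tvar
  rw [map_mul]
  rcases eq_or_ne η 0 with rfl | h
  · rw [map_zero, map_zero, zero_mul]
    exact pow_pos hT0 _
  · rw [valuation_algebraMap h, one_mul]
    exact valuation_QkLS_lt hk

lemma valuation_sub_QkLS_div {k : ℕ} (hk : 1 ≤ k) {z : LaurentSeries F}
    (hz : Valued.v (Tvar F) ^ (2 * k + 1) ≤ Valued.v z) {e : F} (he : e ≠ 0) (η : F) :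
    Valued.v (Tvar F) ≤ Valued.v ((z - algebraMap F (LaurentSeries F) η * QkLS F k) /
      (algebraMap F (LaurentSeries F) e * PkLS F k)) := by
  have hT := one_lt_valuation_Tvar (F := F)
  have hT0 : (0 : ℤᵐ⁰) < Valued.v (Tvar F) := zero_lt_one.trans hT
  have h1 : Valued.v (algebraMap F (LaurentSeries F) η * QkLS F k) < Valued.v z :=
    ((valuation_algebraMap_mul_QkLS_lt hk η).trans
      (pow_lt_pow_right₀ hT (Nat.lt_succ_self (2 * k)))).trans_le hz
  rw [map_div₀, map_mul, valuation_algebraMap he, one_mul, valuation_PkLS,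
    Valuation.map_sub_eq_of_lt_left _ h1, le_div_iff₀ (pow_pos hT0 _), ← pow_succ']
  exact hz

variable {p t k : ℕ} [CharP F p]

/-- The block of `2k` linear partial quotients attached to a pair `(e, δ)`. -/
lemma mobius_block (hp : p.Prime) (hodd : p ≠ 2) (ht : 1 ≤ t) (hk : memE p t k)
    {e δ : F} (he : e ≠ 0) (hδ : δ ≠ 0) {b : ℕ → LaurentSeries F}
    (hb : ∀ j, 1 ≤ j → j ≤ 2 * k → b j = algebraMap F (LaurentSeries F)
      (-vF F k j * e ^ ((-1 : ℤ) ^ (j + 1)) * δ ^ ((-1 : ℤ) ^ j)) * Tvar F)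
    {β y z : LaurentSeries F}
    (hβ : β * (1 - algebraMap F (LaurentSeries F) δ * QkLS F k * z) =
      algebraMap F (LaurentSeries F) e * PkLS F k * z)
    (hy : z = algebraMap F (LaurentSeries F) e⁻¹ * PkLS F k * y +
      algebraMap F (LaurentSeries F) (-(omF F k * δ)⁻¹) * QkLS F k) :
    β * (cden b (2 * k - 1 + 1) * y + cden b (2 * k - 1)) =
      cnum b (2 * k - 1 + 1) * y + cnum b (2 * k - 1) := by
  obtain ⟨hk1, -, -⟩ := hk.two_mul_add_one hp hodd ht
  obtain ⟨c1, c2, c3, -, c5, -, -⟩ := contNum_vF hp hodd ht hk F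
  set ι := algebraMap F (LaurentSeries F) with hι
  set φ : F[X] →+* LaurentSeries F := (aeval (Tvar F) : F[X] →ₐ[F] LaurentSeries F).toRingHom
  have hφC : ∀ c, φ (C c) = ι c := fun c => aeval_C _ _
  have hφX : φ X = Tvar F := aeval_X _
  have hφP : φ ((X ^ 2 - 1) ^ k) = PkLS F k := by
    rw [map_pow, map_sub, map_pow, hφX, map_one, PkLS]
  have hφQ : φ (QkF F k) = QkLS F k := (QkLS_eq_polyT k).symm
  set a : ℕ → LaurentSeries F := fun j => φ (C (vF F k j) * X) with ha
  have d1 : contNum a (2 * k) = ι ((-1) ^ k) * PkLS F k := by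
    rw [ha, ← map_contNum, c1, map_mul, hφC, hφP]
  have d2 : contDen a (2 * k) = ι ((-1) ^ k) * QkLS F k := by
    rw [ha, ← map_contDen, c2, map_mul, hφC, hφQ]
  have d3 : contNum a (2 * k - 1) = ι (-(-1) ^ k * (2 * k * thF F k) ^ 2) * QkLS F k := by
    rw [ha, ← map_contNum, c3, map_mul, hφC, hφQ]
  have d4 := contNum_mul_contDen_sub a (2 * k - 1)
  have hsu : ι (-e * δ⁻¹) * ι (-e⁻¹ * δ) = 1 := by
    rw [← map_mul, ← map_one ι]
    congr 1
    field_simp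
  have ho : ∀ j, 2 * j + 1 ≤ 2 * k → b (2 * j + 1) = ι (-e * δ⁻¹) * a (2 * j + 1) := by
    intro j hj
    have h1 : (-1 : ℤ) ^ (2 * j + 1 + 1) = 1 := Even.neg_one_pow ⟨j + 1, by ring⟩
    have h2 : (-1 : ℤ) ^ (2 * j + 1) = -1 := Odd.neg_one_pow ⟨j, rfl⟩
    rw [hb _ (by omega) hj, h1, h2, zpow_one, zpow_neg_one, ha]
    simp only [map_mul, hφC, hφX, map_neg]
    ring
  have hev : ∀ j, 2 * j + 2 ≤ 2 * k → b (2 * j + 2) = ι (-e⁻¹ * δ) * a (2 * j + 2) := by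
    intro j hj
    have h1 : (-1 : ℤ) ^ (2 * j + 2 + 1) = -1 := Odd.neg_one_pow ⟨j + 1, by ring⟩
    have h2 : (-1 : ℤ) ^ (2 * j + 2) = 1 := Even.neg_one_pow ⟨j + 1, by ring⟩
    rw [hb _ (by omega) hj, h1, h2, zpow_one, zpow_neg_one, ha]
    simp only [map_mul, hφC, hφX, map_neg]
    ring
  have n1 := (contNum_scale hsu ho hev).1 k le_rfl
  have n2 := (contNum_scale hsu ho hev).2 (k - 1) (by omega)
  have n3 := (contDen_scale hsu ho hev).1 k le_rfl
  have n4 := (contDen_scale hsu ho hev).2 (k - 1) (by omega)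
  rw [show 2 * (k - 1) + 1 = 2 * k - 1 by omega] at n2 n4
  rw [show 2 * k - 1 + 1 = 2 * k by omega] at d4 ⊢
  rw [cden_eq_contDen, cden_eq_contDen, cnum_eq_contNum, cnum_eq_contNum, n1, n2, n3, n4, d1, d2,
    d3]
  rw [d1, d2, d3, pow_mul, neg_one_sq, one_pow] at d4
  have hV : ι ((-1) ^ k) * ι ((-1) ^ k) = 1 := by
    rw [← map_mul, ← mul_pow, neg_one_mul, neg_neg, one_pow, map_one]
  have hω0 : omF F k ≠ 0 := fun h => by
    rw [h] at c5
    simp at c5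
  have hκ : ι (-(-1) ^ k * (2 * k * thF F k) ^ 2) = ι ((-1) ^ k) * ι (omF F k)⁻¹ := by
    rw [← map_mul]
    congr 1
    rw [eq_mul_inv_iff_mul_eq₀ hω0]
    linear_combination (-(-1) ^ k) * c5
  rw [hκ] at d4 ⊢
  have hV0 : ι ((-1) ^ k) ≠ 0 := left_ne_zero_of_mul (hV.symm ▸ one_ne_zero)
  refine mul_left_cancel₀ (mul_ne_zero hV0 (PkLS_ne_zero k)) ?_
  have hι0 : ∀ {c : F}, c ≠ 0 → ι c ≠ 0 := fun h => (map_ne_zero ι).2 h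
  have e0 := hι0 he
  have δ0 := hι0 hδ
  have ω0 := hι0 hω0
  generalize ι ((-1) ^ k) = V at *
  generalize contDen a (2 * k - 1) = D at *
  simp only [map_mul, map_neg, map_inv₀] at hy d4 hβ hsu ⊢
  generalize ι e = E at *
  generalize ι δ = Δ at *
  generalize ι (omF F k) = W at *
  generalize PkLS F k = P at *
  generalize QkLS F k = Q at *
  have hPy : P * y = E * (z + (W * Δ)⁻¹ * Q) := by
    rw [hy]
    field_simp
    ring
  have hVP : V * P * D = 1 + W⁻¹ * Q ^ 2 := by
    linear_combination d4 + W⁻¹ * Q ^ 2 * hV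
  have l1 : V * P * (-E⁻¹ * Δ * (V * Q) * y + D) = 1 - Δ * Q * z := by
    have : V * P * (-E⁻¹ * Δ * (V * Q) * y + D) =
        (V * V) * (-E⁻¹ * Δ * Q) * (P * y) + V * P * D := by ring
    rw [this, hV, hPy, hVP]
    field_simp
    ring
  have l2 : V * P * (V * P * y + -E * Δ⁻¹ * (V * W⁻¹ * Q)) = E * P * z := by
    have : V * P * (V * P * y + -E * Δ⁻¹ * (V * W⁻¹ * Q)) =
        (V * V) * P * (P * y - E * Δ⁻¹ * W⁻¹ * Q) := by ring
    rw [this, hV, hPy]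
    field_simp
    ring
  rw [mul_left_comm, l1, l2, hβ]

end TypeRLK

section TypeRLKExpansion

open WithZero

variable {F : Type*} [Field F]

lemma aPQ_of_iIdx_eq_one {r k l : ℕ} {lam : ℕ → F} {n : ℕ} (h : iIdx k l n = 1) :
    aPQ F r k l lam n = algebraMap F (LaurentSeries F) (lam n) * Tvar F := by
  rw [aPQ, h, Aseq, polyT, aeval_X]

lemma zpow_neg_one_pow_add (e : F) (m n : ℕ) :
    e ^ ((-1 : ℤ) ^ (m + n)) = (e ^ ((-1 : ℤ) ^ m)) ^ ((-1 : ℤ) ^ n) := by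
  rw [pow_add, zpow_mul]

/-- The initial complete quotients of a continued fraction of type `(r, l, k)`. -/
lemma completeQuot_of_CFtypeEqn {r k l : ℕ} (hk : 1 ≤ k) (hr : 2 * k + 1 ≤ r) (hl : 1 ≤ l)
    {lam0 lam : ℕ → F} (hlam : ∀ n, 1 ≤ n → lam n ≠ 0)
    (hlam0 : ∀ n, 1 ≤ n → n ≤ l → lam n = lam0 n) {e1 e2 : F} (he1 : e1 ≠ 0)
    {α : LaurentSeries F} (hα : Valued.v (Tvar F) ≤ Valued.v α)
    (heqn : CFtypeEqn F r k l lam0 e1 e2 α) :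
    α ^ r = algebraMap F (LaurentSeries F) e1 * PkLS F k *
        completeQuot (aPQ F r k l lam) α l + algebraMap F (LaurentSeries F) e2 * QkLS F k ∧
      ∀ i ≤ l, Valued.v (Tvar F) ≤ Valued.v (completeQuot (aPQ F r k l lam) α i) := by
  obtain ⟨h, rfl⟩ : ∃ h, l = h + 1 := ⟨l - 1, by omega⟩
  have hT := one_lt_valuation_Tvar (F := F)
  set a := aPQ F r k (h + 1) lam with ha
  have hap : ∀ j, 1 ≤ j → j ≤ h + 1 → aLin F lam0 j = a j := by
    intro j h1 h2
    rw [ha, aPQ_of_iIdx_eq_one (iIdx_of_le h2), aLin, hlam0 j h1 h2]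
  have hP : algebraMap F (LaurentSeries F) e1 * PkLS F k ≠ 0 :=
    mul_ne_zero ((_root_.map_ne_zero _).2 he1) (PkLS_ne_zero k)
  have hy := valuation_sub_QkLS_div hk (z := α ^ r) (by
    rw [map_pow]
    exact (pow_le_pow_right₀ hT.le hr).trans (pow_le_pow_left₀ zero_le hα r)) he1 e2
  rw [CFtypeEqn, Nat.add_sub_cancel, cden_congr (n := h + 1) hap, cnum_congr (n := h + 1) hap,
    cden_congr (n := h) fun j h1 h2 => hap j h1 (by omega),
    cnum_congr (n := h) fun j h1 h2 => hap j h1 (by omega)] at heqn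
  obtain ⟨hc, hle⟩ := completeQuot_of_mobius Valued.v hT a α h _ (fun j h1 h2 => by
    rw [ha, aPQ_of_iIdx_eq_one (iIdx_of_le h2), map_mul, valuation_algebraMap (hlam j h1),
      one_mul]) hy (by
    refine mul_left_cancel₀ hP ?_
    have hd := mul_div_cancel₀ (α ^ r - algebraMap F (LaurentSeries F) e2 * QkLS F k) hP
    linear_combination heqn + (α * cden a (h + 1) - cnum a (h + 1)) * hd)
  refine ⟨?_, hle⟩
  rw [hc, mul_div_cancel₀ _ hP]
  ring

variable {p t k l : ℕ} [CharP F p]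

lemma completeQuot_sub_eq (hp : p.Prime) (hodd : p ≠ 2) (ht : 1 ≤ t) (hk : memE p t k)
    {lam : ℕ → F} {α : LaurentSeries F} {N G : ℕ} {e η δ : F} (he : e ≠ 0)
    (h : completeQuot (aPQ F (p ^ t) k l lam) α N ^ p ^ t =
      algebraMap F (LaurentSeries F) e * PkLS F k * completeQuot (aPQ F (p ^ t) k l lam) α G +
        algebraMap F (LaurentSeries F) η * QkLS F k)
    (hδ : δ = 2 * k * thF F k ^ iIdx k l (N + 1) * lam (N + 1) ^ p ^ t + η) :
    algebraMap F (LaurentSeries F) e * PkLS F k * (completeQuot (aPQ F (p ^ t) k l lam) α G -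
        algebraMap F (LaurentSeries F) (e⁻¹ * lam (N + 1) ^ p ^ t) *
          polyT F (Aseq F (p ^ t) k (iIdx k l (N + 1) + 1))) =
      (completeQuot (aPQ F (p ^ t) k l lam) α (N + 1) ^ p ^ t)⁻¹ -
        algebraMap F (LaurentSeries F) δ * QkLS F k := by
  have : Fact p.Prime := ⟨hp⟩
  have : CharP (LaurentSeries F) p :=
    charP_of_injective_algebraMap (algebraMap F (LaurentSeries F)).injective p
  have hA := polyT_Aseq_pow (F := F) hp hodd ht hk (one_le_iIdx (k := k) (l := l) (N + 1))
  rw [completeQuot_eq_add_inv, add_pow_char_pow, aPQ, mul_pow, hA, inv_pow] at h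
  have hinv : algebraMap F (LaurentSeries F) e * algebraMap F (LaurentSeries F) e⁻¹ = 1 := by
    rw [← map_mul, mul_inv_cancel₀ he, map_one]
  rw [hδ]
  simp only [map_mul, map_add, map_pow] at h ⊢
  linear_combination -h - PkLS F k * algebraMap F (LaurentSeries F) (lam (N + 1)) ^ p ^ t *
    polyT F (Aseq F (p ^ t) k (iIdx k l (N + 1) + 1)) * hinv

end TypeRLKExpansion

section TypeRLKCriterion

open WithZero

variable {F : Type*} [Field F]

lemma valuation_Tvar_le_aPQ {p t k l : ℕ} (hp : p.Prime) (hodd : p ≠ 2) (ht : 1 ≤ t) (hk : memE p t k)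
    {lam : ℕ → F} {n : ℕ} (hn : lam n ≠ 0) :
    Valued.v (Tvar F) ≤ Valued.v (aPQ F (p ^ t) k l lam n) := by
  have hA := one_le_natDegree_Aseq (F := F) hp hodd ht hk (one_le_iIdx (k := k) (l := l) n)
  rw [valuation_aPQ hn hA]
  exact le_self_pow₀ one_lt_valuation_Tvar.le (by omega)

variable {p t k l : ℕ} [CharP F p]

lemma one_le_valuation_QkLS (hp : p.Prime) (hodd : p ≠ 2) (ht : 1 ≤ t) (hk : memE p t k) :
    1 ≤ Valued.v (QkLS F k) := by
  obtain ⟨-, -, -, h, -⟩ := contNum_vF hp hodd ht hk F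
  rw [QkLS_eq_polyT, valuation_polyT]
  · exact one_le_pow₀ one_lt_valuation_Tvar.le
  · intro h0
    rw [h0] at h
    simp at h

lemma omF_ne_zero (hp : p.Prime) (hodd : p ≠ 2) (ht : 1 ≤ t) (hk : memE p t k) :
    omF F k ≠ 0 := by
  obtain ⟨-, -, -, -, h, -⟩ := contNum_vF hp hodd ht hk F
  intro h0
  rw [h0] at h
  simp at h

lemma convergesTo_aPQ (hp : p.Prime) (hodd : p ≠ 2) (ht : 1 ≤ t) (hk : memE p t k) (hl : 1 ≤ l)
    {lam0 lam δ : ℕ → F} {e1 e2 : F} (he1 : e1 ≠ 0) {α : LaurentSeries F}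
    (hα : Valued.v (Tvar F) ≤ Valued.v α) (heqn : CFtypeEqn F (p ^ t) k l lam0 e1 e2 α)
    (hlam : ∀ n, 1 ≤ n → lam n ≠ 0) (hlam0 : ∀ n, 1 ≤ n → n ≤ l → lam n = lam0 n)
    (hδ : ∀ n, δ n ≠ 0) (hδ0 : δ 0 = -(omF F k * e2)⁻¹)
    (hD : ∀ n, 1 ≤ n → δ n = 2 * (k : F) * thF F k ^ iIdx k l n * lam n ^ (p ^ t) -
      (omF F k * δ (n - 1))⁻¹)
    (hL : ∀ n, 1 ≤ n → lam (fIdx k l n) = e1 ^ ((-1 : ℤ) ^ n) * lam n ^ (p ^ t))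
    (hL' : ∀ n, 1 ≤ n → ∀ i, 1 ≤ i → i ≤ 2 * k → lam (fIdx k l n + i) =
      -vF F k i * e1 ^ ((-1 : ℤ) ^ (n + i)) * δ n ^ ((-1 : ℤ) ^ i)) :
    ConvergesTo F (aPQ F (p ^ t) k l lam) α := by
  have hT := one_lt_valuation_Tvar (F := F)
  obtain ⟨hk1, hkt, -⟩ := hk.two_mul_add_one hp hodd ht
  have hω := omF_ne_zero (F := F) hp hodd ht hk
  set a := aPQ F (p ^ t) k l lam with ha
  have hav : ∀ j, 1 ≤ j → Valued.v (Tvar F) ≤ Valued.v (a j) := fun j hj =>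
    valuation_Tvar_le_aPQ hp hodd ht hk (hlam j hj)
  have main : ∀ N, completeQuot a α N ^ p ^ t =
      algebraMap F (LaurentSeries F) (e1 ^ ((-1 : ℤ) ^ N)) * PkLS F k *
        completeQuot a α ((2 * k + 1) * N + l) +
        algebraMap F (LaurentSeries F) (-(omF F k * δ N)⁻¹) * QkLS F k ∧
      ∀ i ≤ (2 * k + 1) * N + l, Valued.v (Tvar F) ≤ Valued.v (completeQuot a α i) := by
    intro N
    induction N with
    | zero =>
      have h := completeQuot_of_CFtypeEqn hk1 hkt hl hlam hlam0 he1 hα heqn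
      rw [mul_zero, zero_add, pow_zero, zpow_one, hδ0,
        show -(omF F k * -(omF F k * e2)⁻¹)⁻¹ = e2 by
          rw [mul_neg, inv_neg, neg_neg, mul_inv, inv_inv, inv_mul_cancel_left₀ hω]]
      exact h
    | succ N ih =>
      obtain ⟨hrel, hle⟩ := ih
      set e := e1 ^ ((-1 : ℤ) ^ N) with he_def
      have he : e ≠ 0 := zpow_ne_zero _ he1
      set G := (2 * k + 1) * N + l with hG
      have hNG : N + 1 ≤ G := by nlinarith
      have hf : fIdx k l (N + 1) = G + 1 := fIdx_succ N
      have hsub := completeQuot_sub_eq hp hodd ht hk he hrel (δ := δ (N + 1)) (by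
        rw [hD (N + 1) (by omega), Nat.add_sub_cancel, sub_eq_add_neg])
      rw [← ha] at hsub
      have haG : a (G + 1) = algebraMap F (LaurentSeries F) (e⁻¹ * lam (N + 1) ^ p ^ t) *
          polyT F (Aseq F (p ^ t) k (iIdx k l (N + 1) + 1)) := by
        rw [ha, aPQ, ← hf, hL (N + 1) (by omega), iIdx_fIdx_succ hk1 hl, zpow_neg_one_pow_add,
          pow_one, zpow_neg_one]
      rw [← haG] at hsub
      set z := completeQuot a α (N + 1) ^ p ^ t with hz
      have hzv : Valued.v (Tvar F) ^ (2 * k + 1) ≤ Valued.v z := by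
        rw [hz, map_pow]
        exact (pow_le_pow_right₀ hT.le hkt).trans (pow_le_pow_left₀ zero_le (hle _ hNG) _)
      have hz1 : 1 < Valued.v z := (one_lt_pow₀ hT (by omega)).trans_le hzv
      have hz0 : z ≠ 0 := by
        intro h
        rw [h, map_zero] at hz1
        exact not_lt_zero hz1
      have hW : 1 - algebraMap F (LaurentSeries F) (δ (N + 1)) * QkLS F k * z ≠ 0 := by
        intro h
        have h1 := congrArg Valued.v (sub_eq_zero.1 h)
        rw [map_one, map_mul, map_mul, valuation_algebraMap (hδ _), one_mul] at h1
        have h2 := one_le_valuation_QkLS (F := F) hp hodd ht hk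
        exact absurd (hz1.trans_le (le_mul_of_one_le_left' h2)) (h1 ▸ lt_irrefl _)
      have hxz : algebraMap F (LaurentSeries F) e * PkLS F k *
          (completeQuot a α G - a (G + 1)) * z =
            1 - algebraMap F (LaurentSeries F) (δ (N + 1)) * QkLS F k * z := by
        rw [hsub, sub_mul, inv_mul_cancel₀ hz0]
      have hx0 : completeQuot a α G - a (G + 1) ≠ 0 := by
        intro h
        rw [h, mul_zero, zero_mul] at hxz
        exact hW hxz.symm
      have hβ : completeQuot a α (G + 1) *
          (1 - algebraMap F (LaurentSeries F) (δ (N + 1)) * QkLS F k * z) =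
            algebraMap F (LaurentSeries F) e * PkLS F k * z := by
        rw [← hxz, completeQuot]
        field_simp
      have he' : e⁻¹ ≠ 0 := inv_ne_zero he
      have hP : algebraMap F (LaurentSeries F) e⁻¹ * PkLS F k ≠ 0 :=
        mul_ne_zero ((_root_.map_ne_zero _).2 he') (PkLS_ne_zero k)
      have hyv := valuation_sub_QkLS_div hk1 hzv he' (-(omF F k * δ (N + 1))⁻¹)
      set y := (z - algebraMap F (LaurentSeries F) (-(omF F k * δ (N + 1))⁻¹) * QkLS F k) /
        (algebraMap F (LaurentSeries F) e⁻¹ * PkLS F k) with hy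
      have hzy : z = algebraMap F (LaurentSeries F) e⁻¹ * PkLS F k * y +
          algebraMap F (LaurentSeries F) (-(omF F k * δ (N + 1))⁻¹) * QkLS F k := by
        rw [hy, mul_div_cancel₀ _ hP, sub_add_cancel]
      have hblock := mobius_block hp hodd ht hk he (hδ (N + 1)) (b := fun j => a (G + 1 + j))
        (fun j h1 h2 => by
          rw [ha, ← hf, aPQ_of_iIdx_eq_one (iIdx_fIdx_add N h1 h2), hL' _ (by omega) j h1 h2,
            add_assoc, zpow_neg_one_pow_add, add_comm 1 j]) hβ hzy
      obtain ⟨h1, h2⟩ := completeQuot_of_mobius Valued.v hT _ _ _ _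
        (fun j _ _ => hav _ (by omega)) hyv hblock
      simp only [completeQuot_add] at h1 h2
      have hG' : (2 * k + 1) * (N + 1) + l = G + 1 + (2 * k - 1 + 1) := by
        rw [hG, mul_add]
        omega
      refine ⟨?_, fun i hi => ?_⟩
      · rw [hG', h1, zpow_neg_one_pow_add, pow_one, zpow_neg_one]
        exact hzy
      · rcases le_or_gt i G with h | h
        · exact hle i h
        · obtain ⟨j, rfl⟩ : ∃ j, i = G + 1 + j := ⟨i - (G + 1), by omega⟩
          exact h2 j (by omega)
  refine convergesTo_of_completeQuot hT a α hav fun i => (main i).2 i ?_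
  nlinarith

/-- The sequence `δ` determined by `(D₁)`. -/
def deltaSeq (F : Type*) [Field F] (r k l : ℕ) (lam : ℕ → F) (e2 : F) : ℕ → F
  | 0 => -(omF F k * e2)⁻¹
  | n + 1 => 2 * (k : F) * thF F k ^ iIdx k l (n + 1) * lam (n + 1) ^ r -
      (omF F k * deltaSeq F r k l lam e2 n)⁻¹

lemma eq_of_valuation_sub_lt {x y : F} {B : LaurentSeries F} (hB : 1 ≤ Valued.v B)
    (h : Valued.v (algebraMap F (LaurentSeries F) x * B -
      algebraMap F (LaurentSeries F) y * B) < 1) : x = y := by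
  by_contra hne
  rw [← sub_mul, ← map_sub, map_mul, valuation_algebraMap (sub_ne_zero.2 hne), one_mul] at h
  exact absurd h (not_lt.2 hB)

lemma relations_of_convergesTo (hp : p.Prime) (hodd : p ≠ 2) (ht : 1 ≤ t) (hk : memE p t k)
    (hl : 1 ≤ l) {lam0 lam : ℕ → F} {e1 e2 : F} (he1 : e1 ≠ 0)
    {α : LaurentSeries F} (hα : Valued.v (Tvar F) ≤ Valued.v α)
    (heqn : CFtypeEqn F (p ^ t) k l lam0 e1 e2 α)
    (hlam : ∀ n, 1 ≤ n → lam n ≠ 0) (hlam0 : ∀ n, 1 ≤ n → n ≤ l → lam n = lam0 n)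
    (hconv : ConvergesTo F (aPQ F (p ^ t) k l lam) α) (N : ℕ) :
    deltaSeq F (p ^ t) k l lam e2 (N + 1) ≠ 0 ∧
      lam (fIdx k l (N + 1)) = e1 ^ ((-1 : ℤ) ^ (N + 1)) * lam (N + 1) ^ (p ^ t) ∧
      ∀ i, 1 ≤ i → i ≤ 2 * k → lam (fIdx k l (N + 1) + i) =
        -vF F k i * e1 ^ ((-1 : ℤ) ^ (N + 1 + i)) *
          deltaSeq F (p ^ t) k l lam e2 (N + 1) ^ ((-1 : ℤ) ^ i) := by
  have hT := one_lt_valuation_Tvar (F := F)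
  obtain ⟨hk1, hkt, -⟩ := hk.two_mul_add_one hp hodd ht
  obtain ⟨-, -, -, -, -, -, hv0⟩ := contNum_vF hp hodd ht hk F
  have hω := omF_ne_zero (F := F) hp hodd ht hk
  set δ := deltaSeq F (p ^ t) k l lam e2 with hδ
  set a := aPQ F (p ^ t) k l lam with ha
  have hav : ∀ j, 1 ≤ j → Valued.v (Tvar F) ≤ Valued.v (a j) := fun j hj =>
    valuation_Tvar_le_aPQ hp hodd ht hk (hlam j hj)
  have hval := completeQuot_of_convergesTo hT a α hav hconv
  have hle : ∀ n, Valued.v (Tvar F) ≤ Valued.v (completeQuot a α n) := fun n => by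
    rw [hval]
    exact hav _ (by omega)
  have step : ∀ N, completeQuot a α N ^ p ^ t =
      algebraMap F (LaurentSeries F) (e1 ^ ((-1 : ℤ) ^ N)) * PkLS F k *
        completeQuot a α ((2 * k + 1) * N + l) +
        algebraMap F (LaurentSeries F) (-(omF F k * δ N)⁻¹) * QkLS F k →
      completeQuot a α (N + 1) ^ p ^ t =
      algebraMap F (LaurentSeries F) (e1 ^ ((-1 : ℤ) ^ (N + 1))) * PkLS F k *
        completeQuot a α ((2 * k + 1) * (N + 1) + l) +
        algebraMap F (LaurentSeries F) (-(omF F k * δ (N + 1))⁻¹) * QkLS F k ∧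
      δ (N + 1) ≠ 0 ∧
      lam (fIdx k l (N + 1)) = e1 ^ ((-1 : ℤ) ^ (N + 1)) * lam (N + 1) ^ (p ^ t) ∧
      ∀ i, 1 ≤ i → i ≤ 2 * k → lam (fIdx k l (N + 1) + i) =
        -vF F k i * e1 ^ ((-1 : ℤ) ^ (N + 1 + i)) * δ (N + 1) ^ ((-1 : ℤ) ^ i) := by
    intro N hrel
    set e := e1 ^ ((-1 : ℤ) ^ N) with he_def
    have he : e ≠ 0 := zpow_ne_zero _ he1
    have he' : e⁻¹ ≠ 0 := inv_ne_zero he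
    have hee : e1 ^ ((-1 : ℤ) ^ (N + 1)) = e⁻¹ := by
      rw [zpow_neg_one_pow_add, pow_one, zpow_neg_one]
    rw [hee]
    set G := (2 * k + 1) * N + l with hG
    have hf : fIdx k l (N + 1) = G + 1 := fIdx_succ N
    have hsub := completeQuot_sub_eq hp hodd ht hk he hrel (δ := δ (N + 1)) (by
      rw [hδ, deltaSeq, sub_eq_add_neg])
    rw [← ha] at hsub
    set z := completeQuot a α (N + 1) ^ p ^ t with hz
    have hzv : Valued.v (Tvar F) ^ (2 * k + 1) ≤ Valued.v z := by
      rw [hz, map_pow]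
      exact (pow_le_pow_right₀ hT.le hkt).trans (pow_le_pow_left₀ zero_le (hle _) _)
    have hz1 : 1 < Valued.v z := (one_lt_pow₀ hT (by omega)).trans_le hzv
    have hz0 : z ≠ 0 := by
      intro h
      rw [h, map_zero] at hz1
      exact not_lt_zero hz1
    have hA := one_le_natDegree_Aseq (F := F) hp hodd ht hk (i := iIdx k l (N + 1) + 1) (by omega)
    have hLD : lam (fIdx k l (N + 1)) = e⁻¹ * lam (N + 1) ^ p ^ t := by
      refine eq_of_valuation_sub_lt
        (B := polyT F (Aseq F (p ^ t) k (iIdx k l (N + 1) + 1))) ?_ ?_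
      · rw [valuation_polyT (ne_zero_of_natDegree_gt hA)]
        exact one_le_pow₀ hT.le
      · have h1 : aPQ F (p ^ t) k l lam (fIdx k l (N + 1)) =
            algebraMap F (LaurentSeries F) (lam (fIdx k l (N + 1))) *
              polyT F (Aseq F (p ^ t) k (iIdx k l (N + 1) + 1)) := by
          rw [aPQ, iIdx_fIdx_succ hk1 hl]
        rw [← h1, ← ha, hf]
        set B := algebraMap F (LaurentSeries F) (e⁻¹ * lam (N + 1) ^ p ^ t) *
          polyT F (Aseq F (p ^ t) k (iIdx k l (N + 1) + 1))
        have h2 : Valued.v (completeQuot a α G - B) < 1 := by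
          have h3 := congrArg Valued.v hsub
          rw [map_mul, map_mul, valuation_algebraMap he, one_mul, valuation_PkLS] at h3
          have hT0 : (0 : ℤᵐ⁰) < Valued.v (Tvar F) ^ (2 * k) := pow_pos (zero_lt_one.trans hT) _
          refine lt_of_mul_lt_mul_left' (a := Valued.v (Tvar F) ^ (2 * k)) ?_
          rw [h3, mul_one]
          refine (Valuation.map_sub _ _ _).trans_lt
            (max_lt ?_ (valuation_algebraMap_mul_QkLS_lt hk1 _))
          rw [map_inv₀]
          exact (inv_lt_one_of_one_lt₀ hz1).trans_le (one_le_pow₀ hT.le)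
        have h3 : a (G + 1) - B = completeQuot a α G - B - (completeQuot a α (G + 1))⁻¹ := by
          rw [completeQuot_eq_add_inv a α G]
          ring
        rw [h3]
        exact (Valuation.map_sub _ _ _).trans_lt
          (max_lt h2 (valuation_inv_lt_one Valued.v hT (hle _)))
    have haG : a (G + 1) = algebraMap F (LaurentSeries F) (e⁻¹ * lam (N + 1) ^ p ^ t) *
        polyT F (Aseq F (p ^ t) k (iIdx k l (N + 1) + 1)) := by
      rw [ha, aPQ, ← hf, hLD, iIdx_fIdx_succ hk1 hl]
    rw [← haG, completeQuot_eq_add_inv a α G, add_sub_cancel_left] at hsub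
    have hβ0 : completeQuot a α (G + 1) ≠ 0 := ne_zero_of_le_valuation Valued.v hT (hle _)
    have hβ : completeQuot a α (G + 1) *
        (1 - algebraMap F (LaurentSeries F) (δ (N + 1)) * QkLS F k * z) =
          algebraMap F (LaurentSeries F) e * PkLS F k * z := by
      field_simp at hsub
      linear_combination -hsub
    have hδ0 : δ (N + 1) ≠ 0 := by
      intro h0
      rw [h0, map_zero, zero_mul, zero_mul, sub_zero, mul_one] at hβ
      have h1 := hval (G + 1)
      rw [ha, aPQ_of_iIdx_eq_one (by rw [← hf]; exact iIdx_fIdx_add N le_rfl (by omega)), ← ha,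
        hβ, map_mul, map_mul, map_mul, valuation_algebraMap he,
        valuation_algebraMap (hlam _ (by omega)), one_mul, one_mul, valuation_PkLS] at h1
      have h2 : Valued.v (Tvar F) < Valued.v (Tvar F) ^ (2 * k) * Valued.v z := by
        refine (le_self_pow₀ hT.le (show 2 * k ≠ 0 by omega)).trans_lt ?_
        exact lt_mul_of_one_lt_right (pow_pos (zero_lt_one.trans hT) _) hz1
      exact h2.ne' h1
    have hP : algebraMap F (LaurentSeries F) e⁻¹ * PkLS F k ≠ 0 :=
      mul_ne_zero ((_root_.map_ne_zero _).2 he') (PkLS_ne_zero k)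
    have hyv := valuation_sub_QkLS_div hk1 hzv he' (-(omF F k * δ (N + 1))⁻¹)
    set y := (z - algebraMap F (LaurentSeries F) (-(omF F k * δ (N + 1))⁻¹) * QkLS F k) /
      (algebraMap F (LaurentSeries F) e⁻¹ * PkLS F k) with hy
    have hzy : z = algebraMap F (LaurentSeries F) e⁻¹ * PkLS F k * y +
        algebraMap F (LaurentSeries F) (-(omF F k * δ (N + 1))⁻¹) * QkLS F k := by
      rw [hy, mul_div_cancel₀ _ hP, sub_add_cancel]
    set μ : ℕ → F := fun j =>
      -vF F k j * e ^ ((-1 : ℤ) ^ (j + 1)) * δ (N + 1) ^ ((-1 : ℤ) ^ j) with hμ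
    have hμ0 : ∀ j, 1 ≤ j → j ≤ 2 * k → μ j ≠ 0 := fun j h1 h2 =>
      mul_ne_zero (mul_ne_zero (neg_ne_zero.2 (hv0 j h1 h2)) (zpow_ne_zero _ he))
        (zpow_ne_zero _ hδ0)
    have hblock := mobius_block hp hodd ht hk he hδ0
      (b := fun j => algebraMap F (LaurentSeries F) (μ j) * Tvar F) (fun _ _ _ => rfl) hβ hzy
    have haj : ∀ j, 1 ≤ j → j ≤ 2 * k →
        a (G + 1 + j) = algebraMap F (LaurentSeries F) (lam (G + 1 + j)) * Tvar F := by
      intro j h1 h2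
      rw [ha, aPQ_of_iIdx_eq_one]
      rw [← hf]
      exact iIdx_fIdx_add N h1 h2
    have hlamμ : ∀ j, 1 ≤ j → j ≤ 2 * k →
        Valued.v (a (G + 1 + j) - algebraMap F (LaurentSeries F) (μ j) * Tvar F) < 1 →
        lam (G + 1 + j) = μ j := by
      intro j h1 h2 h
      rw [haj j h1 h2] at h
      exact eq_of_valuation_sub_lt hT.le h
    obtain ⟨h1, h2⟩ := eq_of_mobius Valued.v hT (fun j => a (G + 1 + j)) _ _ _ _
      (fun j h1 h2 => by
        rw [map_mul, valuation_algebraMap (hμ0 j h1 (by omega)), one_mul]) hyv hblock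
      (fun i _ => by
        rw [completeQuot_add]
        exact hle _)
      (fun j h1 h2 h => by
        rw [haj j h1 (by omega), hlamμ j h1 (by omega) h])
    rw [completeQuot_add] at h2
    refine ⟨?_, hδ0, hLD, fun i hi1 hi2 => ?_⟩
    · have hG' : (2 * k + 1) * (N + 1) + l = G + 1 + (2 * k - 1 + 1) := by
        rw [hG, mul_add]
        omega
      rw [hG', h2]
      exact hzy
    · rw [hf, hlamμ i hi1 hi2 (by rw [h1 i hi1 (by omega), sub_self, map_zero]; exact zero_lt_one),
        hμ, add_assoc, zpow_neg_one_pow_add, add_comm 1 i]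
  refine (step N ?_).2
  induction N with
  | zero =>
    have h := (completeQuot_of_CFtypeEqn hk1 hkt hl hlam hlam0 he1 hα heqn).1
    rw [mul_zero, zero_add, pow_zero, zpow_one, hδ, deltaSeq,
      show -(omF F k * -(omF F k * e2)⁻¹)⁻¹ = e2 by
        rw [mul_neg, inv_neg, neg_neg, mul_inv, inv_inv, inv_mul_cancel_left₀ hω]]
    exact h
  | succ N ih => exact (step N ih).1

end TypeRLKCriterion

/-- Lemma 5.1: for a continued fraction `α` of type `(r,l,k)`, the partial quotients
satisfy `a_n = λ_n A_{i(n)}` (for some sequence `(λ_n)` in `F_q*` extending the data)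
if and only if there are sequences `(λ_n)` in `F_q*` (extending the data) and
`(δ_n)` in `F_q*` with `δ_0 = -(ω_k ε₂)⁻¹`, satisfying
`(D₁) : δ_n = 2k θ_k^(i(n)) λ_n^r - (ω_k δ_{n-1})⁻¹` for `n ≥ 1` and
`(LD) : λ_{f(n)} = ε₁^((-1)^n) λ_n^r`,
`λ_{f(n)+i} = -v_{i,k} ε₁^((-1)^(n+i)) δ_n^((-1)^i)` for `n ≥ 1`, `1 ≤ i ≤ 2k`. -/
theorem statement8 (p s t : ℕ) (hp : p.Prime) (hodd : p ≠ 2) (hs : 1 ≤ s) (ht : 1 ≤ t)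
    (Fq : Type*) [Field Fq] [Fintype Fq] (hq : Fintype.card Fq = p ^ s)
    (k : ℕ) (hk : memE p t k) (l : ℕ) (hl : 1 ≤ l)
    (lam0 : ℕ → Fq) (hlam0 : ∀ n, 1 ≤ n → n ≤ l → lam0 n ≠ 0)
    (e1 e2 : Fq) (he1 : e1 ≠ 0) (he2 : e2 ≠ 0)
    (α : LaurentSeries Fq) (hord : α ≠ 0 ∧ α.order ≤ -1)
    (heqn : CFtypeEqn Fq (p ^ t) k l lam0 e1 e2 α) :
    (∃ lam : ℕ → Fq, (∀ n, 1 ≤ n → lam n ≠ 0) ∧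
        (∀ n, 1 ≤ n → n ≤ l → lam n = lam0 n) ∧
        ConvergesTo Fq (aPQ Fq (p ^ t) k l lam) α) ↔
    (∃ lam : ℕ → Fq, ∃ δ : ℕ → Fq,
        (∀ n, 1 ≤ n → lam n ≠ 0) ∧ (∀ n, 1 ≤ n → n ≤ l → lam n = lam0 n) ∧
        (∀ n, δ n ≠ 0) ∧ δ 0 = -(omF Fq k * e2)⁻¹ ∧
        (∀ n, 1 ≤ n →
          δ n = 2 * (k : Fq) * thF Fq k ^ iIdx k l n * lam n ^ (p ^ t) -
            (omF Fq k * δ (n - 1))⁻¹) ∧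
        (∀ n, 1 ≤ n → lam (fIdx k l n) = e1 ^ ((-1 : ℤ) ^ n) * lam n ^ (p ^ t)) ∧
        (∀ n, 1 ≤ n → ∀ i, 1 ≤ i → i ≤ 2 * k →
          lam (fIdx k l n + i) =
            -vF Fq k i * e1 ^ ((-1 : ℤ) ^ (n + i)) * δ n ^ ((-1 : ℤ) ^ i))) := by
  have := Fact.mk hp
  have := charP_of_card_eq_prime_pow hq
  have hα := valuation_Tvar_le hord.1 hord.2
  constructor
  · rintro ⟨lam, hlam, hlam', hconv⟩
    have key := relations_of_convergesTo hp hodd ht hk hl he1 (e2 := e2) hα heqn hlam hlam' hconv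
    refine ⟨lam, deltaSeq Fq (p ^ t) k l lam e2, hlam, hlam', fun n => ?_, rfl, fun n hn => ?_,
      fun n hn => ?_, fun n hn => ?_⟩
    · cases n with
      | zero => exact neg_ne_zero.2 (inv_ne_zero (mul_ne_zero (omF_ne_zero hp hodd ht hk) he2))
      | succ N => exact (key N).1
    all_goals obtain ⟨N, rfl⟩ := Nat.exists_eq_add_of_le' hn
    · rfl
    · exact_mod_cast (key N).2.1
    · exact_mod_cast (key N).2.2
  · rintro ⟨lam, δ, hlam, hlam', hδ, hδ0, hD, hL, hL'⟩
    exact ⟨lam, hlam, hlam', convergesTo_aPQ hp hodd ht hk hl he1 hα heqn hlam hlam' hδ hδ0 hD hL hL'⟩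
end
end
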